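/- Let G be a finite simple claw-free minimal 2-extendable graph with δ(G) ≥ 6. Let e = uv be an edge of G and let S_e ⊆ V(G)∖{u,v} be a set of minimum cardinality among all sets S satisfying: G[S] has a matching of size at least 2; the number of odd components of G − e − S equals |S| − 2; and u and v belong to two distinct odd components of G − e − S. Let O_1, O_2, …, O_t be the odd components of G_e := G − e − S_e with u ∈ V(O_1) and v ∈ V(O_2). Then every maximum matching of G[S_e] has size exactly 2, and one of the following holds: (i) |S_e| = 4, t = 2, and |V(O_1)| > 1 and |V(O_2)| > 1; or (ii) |S_e| = 5, t = 3, |V(O_1)| = |V(O_2)| = 1, G_e has no component of even order, and for every maximum matching M of G[S_e] the unique vertex w of S_e not covered by M satisfies uw ∈ E(G), vw ∈ E(G), and w has a neighbor in O_3. -/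

import Mathlib

open SimpleGraph

/-- A graph `G` is `k`-extendable if it is connected, has a perfect matching, and every
matching of size `k` is contained in a perfect matching. -/
def KExt {V : Type*} [Fintype V] (G : SimpleGraph V) (k : ℕ) : Prop :=
  G.Connected ∧ (∃ P : G.Subgraph, P.IsPerfectMatching) ∧
    ∀ M : G.Subgraph, M.IsMatching → M.edgeSet.ncard = k →
      ∃ P : G.Subgraph, P.IsPerfectMatching ∧ M ≤ P

/-- A `k`-extendable graph is minimal if deleting any edge destroys `k`-extendability. -/
def MinimalKExt {V : Type*} [Fintype V] (G : SimpleGraph V) (k : ℕ) : Prop :=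
  KExt G k ∧ ∀ e ∈ G.edgeSet, ¬ KExt (G.deleteEdges {e}) k

/-- A graph is claw-free if it has no induced subgraph isomorphic to `K_{1,3}`. -/
def ClawFree {V : Type*} (G : SimpleGraph V) : Prop :=
  ∀ u a b c : V, G.Adj u a → G.Adj u b → G.Adj u c →
    a ≠ b → a ≠ c → b ≠ c → ¬G.Adj a b → ¬G.Adj a c → ¬G.Adj b c → False

/-- The graph `G - e - S` obtained from `G` by deleting the edge `e = uv` and the vertices
of `S`. -/
def Ge {V : Type*} (G : SimpleGraph V) (u v : V) (S : Set V) : SimpleGraph ↑(Sᶜ) :=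
  (G.deleteEdges {s(u, v)}).induce Sᶜ

/-- `S` is an admissible set for the edge `uv` (with parameter `k`): `S ⊆ V ∖ {u, v}`,
`G[S]` has a matching of size at least `k`, the number of odd components of `G - uv - S`
equals `|S| - 2k + 2`, and `u`, `v` lie in two distinct odd components of `G - uv - S`. -/
def Admissible {V : Type*} [Fintype V] (G : SimpleGraph V) (k : ℕ) (u v : V) (S : Set V) :
    Prop :=
  u ∉ S ∧ v ∉ S ∧
  (∃ M : G.Subgraph, M.IsMatching ∧ M.verts ⊆ S ∧ k ≤ M.edgeSet.ncard) ∧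
  Set.ncard {C : (Ge G u v S).ConnectedComponent | Odd C.supp.ncard} + 2 * k = S.ncard + 2 ∧
  ∃ (hu : u ∈ Sᶜ) (hv : v ∈ Sᶜ),
    (Ge G u v S).connectedComponentMk ⟨u, hu⟩ ≠ (Ge G u v S).connectedComponentMk ⟨v, hv⟩ ∧
    Odd ((Ge G u v S).connectedComponentMk ⟨u, hu⟩).supp.ncard ∧
    Odd ((Ge G u v S).connectedComponentMk ⟨v, hv⟩).supp.ncard

set_option linter.unusedSectionVars false

section

variable {V : Type*}

/-- `S` contains two disjoint edges of `G`. -/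
def TwoMatching (G : SimpleGraph V) (S : Finset V) : Prop :=
  ∃ a b c d, a ∈ S ∧ b ∈ S ∧ c ∈ S ∧ d ∈ S ∧ G.Adj a b ∧ G.Adj c d ∧
    a ≠ c ∧ a ≠ d ∧ b ≠ c ∧ b ≠ d

/-- A family of pairwise disjoint odd sets, each a union of components of `H - S`. -/
structure OddFamily (H : SimpleGraph V) (S : Finset V) (F : Finset (Finset V)) : Prop where
  odd : ∀ O ∈ F, Odd O.card
  disj : ∀ O ∈ F, ∀ O' ∈ F, ∀ x, x ∈ O → x ∈ O' → O = O'
  notMem : ∀ O ∈ F, ∀ x ∈ O, x ∉ S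
  closed : ∀ O ∈ F, ∀ x ∈ O, ∀ y, H.Adj x y → y ∈ O ∨ y ∈ S

/-- The properties of a claw-free 2-extendable graph with minimum degree at least 6, with
perfect matchings encoded as fixed-point-free involutions. -/
structure Ambient (G : SimpleGraph V) [Fintype V] : Prop where
  claw : ClawFree G
  conn : G.Connected
  even : Even (Fintype.card V)
  deg : ∀ x, ∀ T : Finset V, (∀ y, G.Adj x y → y ∈ T) → 6 ≤ T.card
  ext : ∀ a b c d, G.Adj a b → G.Adj c d → a ≠ c → a ≠ d → b ≠ c → b ≠ d →
    ∃ f : V → V, (∀ x, G.Adj x (f x)) ∧ (∀ x, f (f x) = x) ∧ f a = b ∧ f c = d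

theorem Finset.even_card_of_involution {O : Finset V} (f : V → V) (hf : ∀ x, f x ≠ x)
    (hff : ∀ x, f (f x) = x) (hO : ∀ x ∈ O, f x ∈ O) : Even O.card := by
  have h : ∑ x ∈ O, (1 : ZMod 2) = 0 :=
    Finset.sum_involution (fun x _ => f x) (fun _ _ => by decide) (fun x _ _ => hf x) hO
      (fun x _ => hff x)
  simp only [Finset.sum_const, nsmul_eq_mul, mul_one] at h
  exact (ZMod.natCast_eq_zero_iff_even).1 h

variable [Fintype V] {G : SimpleGraph V}

theorem Ambient.exists_adj_notMem (hG : Ambient G) (x : V) {T : Finset V} (hT : T.card ≤ 5) :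
    ∃ y, G.Adj x y ∧ y ∉ T := by
  by_contra! h
  have := hG.deg x T h
  omega

theorem Ambient.exists_adj_of_mem (hG : Ambient G) {X : Finset V} (hX : X.Nonempty)
    (hne : ∃ z, z ∉ X) : ∃ x ∈ X, ∃ y, y ∉ X ∧ G.Adj x y := by
  obtain ⟨x, hx⟩ := hX
  obtain ⟨z, hz⟩ := hne
  obtain ⟨p⟩ := hG.conn.preconnected x z
  obtain ⟨d, -, h1, h2⟩ := p.exists_boundary_dart (X : Set V) (by simpa) (by simpa)
  exact ⟨d.fst, by simpa using h1, d.snd, by simpa using h2, d.adj⟩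

variable [DecidableEq V]

theorem Ambient.card_add_four_le (hG : Ambient G) {S : Finset V} {F : Finset (Finset V)}
    (hS : TwoMatching G S) (hF : OddFamily G S F) : F.card + 4 ≤ S.card := by
  obtain ⟨a, b, c, d, ha, hb, hc, hd, hab, hcd, h1, h2, h3, h4⟩ := hS
  obtain ⟨f, hf, hff, fa, fc⟩ := hG.ext a b c d hab hcd h1 h2 h3 h4
  have fb : f b = a := by rw [← fa, hff]
  have fd : f d = c := by rw [← fc, hff]
  have key : ∀ O ∈ F, ∃ x ∈ O, f x ∉ O := by
    intro O hO
    by_contra! h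
    exact Nat.not_even_iff_odd.2 (hF.odd O hO)
      (Finset.even_card_of_involution f (fun x => (hf x).ne') hff h)
  have : Nonempty V := ⟨a⟩
  choose! g hg hg' using key
  have hsub : F.image (fun O => f (g O)) ⊆ S \ {a, b, c, d} := by
    intro y hy
    obtain ⟨O, hO, rfl⟩ := Finset.mem_image.1 hy
    have h5 := (hF.closed O hO _ (hg O hO) _ (hf _)).resolve_left (hg' O hO)
    have h6 := hF.notMem O hO _ (hg O hO)
    have h7 := hff (g O)
    simp only [Finset.mem_sdiff, Finset.mem_insert, Finset.mem_singleton, h5, true_and]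
    rintro (h | h | h | h) <;> rw [h] at h7 <;> grind
  have hcard := Finset.card_le_card hsub
  rw [Finset.card_image_of_injOn, Finset.card_sdiff_of_subset] at hcard
  · have h8 : ({a, b, c, d} : Finset V).card = 4 := by
      have := hab.ne
      have := hcd.ne
      rw [Finset.card_insert_of_notMem, Finset.card_insert_of_notMem, Finset.card_pair] <;> grind
    have : ({a, b, c, d} : Finset V).card ≤ S.card := Finset.card_le_card (by grind)
    omega
  · grind
  · intro O hO O' hO' h
    have : g O = g O' := by rw [← hff (g O), ← hff (g O')]; exact congrArg f h
    exact hF.disj O hO O' hO' _ (hg O hO) (this ▸ hg O' hO')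

/-- An odd set cannot be separated from the rest of the graph by two disjoint edges. -/
theorem Ambient.not_odd_separated (hG : Ambient G) {O : Finset V} (hO : Odd O.card)
    {a b c d : V} (hab : G.Adj a b) (hcd : G.Adj c d)
    (h1 : a ≠ c) (h2 : a ≠ d) (h3 : b ≠ c) (h4 : b ≠ d)
    (ha : a ∉ O) (hb : b ∉ O) (hc : c ∉ O) (hd : d ∉ O)
    (hcl : ∀ x ∈ O, ∀ y, G.Adj x y → y ∈ O ∨ y = a ∨ y = b ∨ y = c ∨ y = d) : False := by
  have := hG.card_add_four_le (S := {a, b, c, d}) (F := {O})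
    ⟨a, b, c, d, by simp, by simp, by simp, by simp, hab, hcd, h1, h2, h3, h4⟩
    { odd := by simpa
      disj := by simp
      notMem := by grind
      closed := by grind }
  have h5 : ({a, b, c, d} : Finset V).card ≤ 4 := Finset.card_le_four
  rw [Finset.card_singleton] at this
  omega

/-- Complementary sides of a separation by a small set. -/
theorem Ambient.two_le_card_of_separates (hG : Ambient G) {X C : Finset V} (hX : X.Nonempty)
    (hcl : ∀ x ∈ X, ∀ y, G.Adj x y → y ∈ X ∨ y ∈ C) (hz : ∃ z, z ∉ X ∧ z ∉ C)
    (hd : Disjoint X C) : 2 ≤ C.card := by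
  by_contra! hlt
  obtain ⟨z, hzX, hzC⟩ := hz
  obtain ⟨x, hx, c, hcX, hxc⟩ := hG.exists_adj_of_mem hX ⟨z, hzX⟩
  have hcC := (hcl x hx c hxc).resolve_left hcX
  have hC : C = {c} := by
    obtain ⟨e, he⟩ := Finset.card_eq_one.1
      (by have := Finset.card_pos.2 ⟨c, hcC⟩; omega : C.card = 1)
    grind
  subst hC
  set Y : Finset V := Finset.univ \ (insert c X) with hY
  have hYc : ∀ x ∈ Y, ∀ y, G.Adj x y → y ∈ Y ∨ y = c := by
    intro x hx y hxy
    have := hcl y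
    have := hxy.symm
    grind
  obtain ⟨y, hy, c', hc'Y, hyc⟩ := hG.exists_adj_of_mem (X := Y) ⟨z, by grind⟩ ⟨x, by grind⟩
  obtain rfl : c' = c := (hYc y hy c' hyc).resolve_left hc'Y
  have hcard : X.card + Y.card + 1 = Fintype.card V := by
    rw [hY, Finset.card_sdiff_of_subset (Finset.subset_univ _), Finset.card_univ]
    have := Finset.card_insert_of_notMem hcX
    have := Finset.card_le_univ (insert c' X)
    omega
  have hev := hG.even
  have aux : ∀ A B : Finset V, Even A.card → (∀ x ∈ A, ∀ y, G.Adj x y → y ∈ A ∨ y = c') →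
      (∀ x ∈ B, ∀ y, G.Adj x y → y ∈ B ∨ y = c') → Disjoint A B → c' ∉ A → c' ∉ B →
      ∀ x ∈ A, G.Adj x c' → B.Nonempty → False := by
    intro A B hA hAc hBc hAB hcA hcB x hx hxc ⟨w, hw⟩
    obtain ⟨w', hww', hw'⟩ := hG.exists_adj_notMem w (T := {c'}) (by simp)
    have hAB' := Finset.disjoint_left.1 hAB
    have hw'B := (hBc w hw w' hww').resolve_right (by simpa using hw')
    refine hG.not_odd_separated (O := A.erase x) ?_ hxc hww' ?_ ?_ ?_ ?_ ?_ ?_ ?_ ?_ ?_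
    · rw [Finset.card_erase_of_mem hx]
      have := Finset.card_pos.2 ⟨x, hx⟩
      exact Nat.Even.sub_odd this hA odd_one
    all_goals grind
  have hXY : Disjoint X Y := by
    rw [Finset.disjoint_left]; grind
  rcases Nat.even_or_odd X.card with h | h
  · exact aux X Y h (by simpa using hcl) hYc hXY hcX (by grind) x hx hxc ⟨y, hy⟩
  · refine aux Y X ?_ hYc (by simpa using hcl) hXY.symm (by grind) hcX y hy hyc ⟨x, hx⟩
    rw [← hcard] at hev
    grind

/-- A claw-free 2-extendable graph of large minimum degree is 3-connected. -/
theorem Ambient.three_le_card_of_separates (hG : Ambient G) {X C : Finset V}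
    (hX : X.Nonempty) (hcl : ∀ x ∈ X, ∀ y, G.Adj x y → y ∈ X ∨ y ∈ C)
    (hz : ∃ z, z ∉ X ∧ z ∉ C) : 3 ≤ C.card := by
  wlog hd : Disjoint X C generalizing C
  · refine (this (C := C \ X) (by grind) (by grind) ?_).trans
      (Finset.card_le_card Finset.sdiff_subset)
    exact Finset.disjoint_sdiff
  by_contra! hlt
  have h2 := hG.two_le_card_of_separates hX hcl hz hd
  obtain ⟨z, hzX, hzC⟩ := hz
  have hdl := Finset.disjoint_left.1 hd
  obtain ⟨c, d, hcd, rfl⟩ := Finset.card_eq_two.1 (by omega : C.card = 2)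
  set Y : Finset V := Finset.univ \ (X ∪ {c, d}) with hY
  have hYc : ∀ x ∈ Y, ∀ y, G.Adj x y → y ∈ Y ∨ y ∈ ({c, d} : Finset V) := by
    intro x hx y hxy
    have := hcl y
    have := hxy.symm
    grind
  have hYne : Y.Nonempty := ⟨z, by grind⟩
  have hXY : Disjoint X Y := by
    rw [Finset.disjoint_left]; grind
  have hcard : X.card + Y.card + 2 = Fintype.card V := by
    rw [hY, Finset.card_sdiff_of_subset (Finset.subset_univ _), Finset.card_univ]
    have := Finset.card_union_of_disjoint hd
    have := Finset.card_le_univ (X ∪ {c, d})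
    rw [Finset.card_pair hcd] at *
    omega
  have nbr : ∀ A B : Finset V, A.Nonempty → B.Nonempty → Disjoint A B →
      (∀ x ∈ A, ∀ y, G.Adj x y → y ∈ A ∨ y ∈ ({c, d} : Finset V)) → c ∉ A → d ∉ A → c ∉ B →
      d ∉ B → ∀ e ∈ ({c, d} : Finset V), ∃ x ∈ A, G.Adj x e := by
    intro A B hA ⟨b, hb⟩ hAB hAc h1 h2 h3 h4 e he
    have hAB' := Finset.disjoint_left.1 hAB
    by_contra! hno
    have := hG.two_le_card_of_separates (X := A) (C := ({c, d} : Finset V).erase e) hA (by grind)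
      ⟨b, by grind⟩ (by rw [Finset.disjoint_left]; grind)
    rw [Finset.card_erase_of_mem he, Finset.card_pair hcd] at this
    omega
  have hcX : c ∉ X := by grind
  have hdX : d ∉ X := by grind
  have hcY : c ∉ Y := by grind
  have hdY : d ∉ Y := by grind
  have nX := nbr X Y hX hYne hXY hcl hcX hdX hcY hdY
  have nY := nbr Y X hYne hX hXY.symm hYc hcY hdY hcX hdX
  have hXY' := Finset.disjoint_left.1 hXY
  rcases Nat.even_or_odd X.card with h | h
  · obtain ⟨a, ha, hac⟩ := nX c (by simp)
    obtain ⟨b, hb, hbd⟩ := nY d (by simp)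
    refine hG.not_odd_separated (O := X.erase a) ?_ hac hbd ?_ ?_ ?_ ?_ ?_ ?_ ?_ ?_ ?_
    · rw [Finset.card_erase_of_mem ha]
      exact Nat.Even.sub_odd (Finset.card_pos.2 ⟨a, ha⟩) h odd_one
    all_goals grind
  · by_cases hne : ∃ a ∈ X, ∃ a' ∈ X, a ≠ a' ∧ G.Adj a c ∧ G.Adj a' d
    · obtain ⟨a, ha, a', ha', hne, hac, had⟩ := hne
      refine hG.not_odd_separated (O := (X.erase a).erase a') ?_ hac had hne ?_ ?_ ?_ ?_ ?_ ?_ ?_ ?_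
      · have h5 : a' ∈ X.erase a := by grind
        have := Finset.card_pos.2 ⟨a', h5⟩
        rw [Finset.card_erase_of_mem h5]
        rw [Finset.card_erase_of_mem ha] at *
        grind
      all_goals grind
    · push Not at hne
      obtain ⟨a, ha, hac⟩ := nX c (by simp)
      obtain ⟨y, hay, hy⟩ := hG.exists_adj_notMem a (T := {c, d}) (Finset.card_le_two.trans (by simp))
      have := hG.two_le_card_of_separates (X := X.erase a) (C := {a})
        ⟨y, Finset.mem_erase.2 ⟨hay.ne', (hcl a ha y hay).resolve_right hy⟩⟩ ?_ ⟨z, by grind⟩ (by simp)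
      · simp at this
      · intro x hx y hxy
        obtain ⟨a', ha', had⟩ := nX d (by simp)
        grind

end

section

variable {V : Type*} [Fintype V] [DecidableEq V] {G : SimpleGraph V}

theorem SimpleGraph.Adj.deleteEdges_of_ne {u v x y : V} (h : G.Adj x y)
    (hu : x = u → y ≠ v) (hv : x = v → y ≠ u) : (G.deleteEdges {s(u, v)}).Adj x y := by
  rw [deleteEdges_adj]
  refine ⟨h, ?_⟩
  rw [Set.mem_singleton_iff, Sym2.eq_iff]
  grind

theorem OddFamily.mono {H : SimpleGraph V} {S : Finset V} {F F' : Finset (Finset V)}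
    (hF : OddFamily H S F) (h : F' ⊆ F) : OddFamily H S F' where
  odd O hO := hF.odd O (h hO)
  disj O hO O' hO' := hF.disj O (h hO) O' (h hO')
  notMem O hO := hF.notMem O (h hO)
  closed O hO := hF.closed O (h hO)

theorem OddFamily.card_filter_mem_le_one {H : SimpleGraph V} {S : Finset V}
    {F : Finset (Finset V)} (hF : OddFamily H S F) (x : V) :
    (F.filter (x ∈ ·)).card ≤ 1 := by
  rw [Finset.card_le_one]
  intro O hO O' hO'
  rw [Finset.mem_filter] at hO hO'
  exact hF.disj O hO.1 O' hO'.1 x hO.2 hO'.2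

theorem Ambient.card_add_two_le (hG : Ambient G) {u v : V} {S : Finset V}
    {F : Finset (Finset V)} (hS : TwoMatching G S)
    (hF : OddFamily (G.deleteEdges {s(u, v)}) S F) :
    F.card + 2 ≤ S.card ∧ (S.card ≤ F.card + 2 →
      ∃ A ∈ F, ∃ B ∈ F, A ≠ B ∧ u ∈ A ∧ v ∈ B) := by
  set F₀ := F.filter (fun O => u ∉ O ∧ v ∉ O) with hF₀
  have h0 : OddFamily G S F₀ := by
    have h := hF.mono (F' := F₀) (Finset.filter_subset _ _)
    refine ⟨h.odd, h.disj, h.notMem, fun O hO x hx y hxy => h.closed O hO x hx y ?_⟩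
    have := (Finset.mem_filter.1 hO).2
    exact hxy.deleteEdges_of_ne (by grind) (by grind)
  have h1 := hG.card_add_four_le hS h0
  have hu := hF.card_filter_mem_le_one u
  have hv := hF.card_filter_mem_le_one v
  have h2 : F.card ≤ F₀.card + (F.filter (u ∈ ·) ∪ F.filter (v ∈ ·)).card :=
    (Finset.card_le_card (by intro O hO; simp [hF₀]; grind)).trans (Finset.card_union_le _ _)
  have h3 := Finset.card_union_le (F.filter (u ∈ ·)) (F.filter (v ∈ ·))
  refine ⟨by omega, fun hle => ?_⟩
  obtain ⟨A, hA⟩ := Finset.card_eq_one.1 (by omega : (F.filter (u ∈ ·)).card = 1)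
  obtain ⟨B, hB⟩ := Finset.card_eq_one.1 (by omega : (F.filter (v ∈ ·)).card = 1)
  have hA' := Finset.mem_filter.1 (hA ▸ Finset.mem_singleton_self A)
  have hB' := Finset.mem_filter.1 (hB ▸ Finset.mem_singleton_self B)
  refine ⟨A, hA'.1, B, hB'.1, ?_, hA'.2, hB'.2⟩
  rintro rfl
  rw [hA, hB, Finset.union_self, Finset.card_singleton] at h2
  omega

/-- A minimum separating set `S` for the edge `uv`, together with the family `F` of odd
components of `G - uv - S`, of which `A` and `B` contain `u` and `v`. -/
structure Config (G : SimpleGraph V) (u v : V) (S : Finset V) (F : Finset (Finset V))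
    (A B : Finset V) : Prop where
  adj : G.Adj u v
  two : TwoMatching G S
  card : F.card + 2 = S.card
  fam : OddFamily (G.deleteEdges {s(u, v)}) S F
  memA : A ∈ F
  memB : B ∈ F
  ne : A ≠ B
  hu : u ∈ A
  hv : v ∈ B
  conn : ∀ O ∈ F, ∀ X ⊆ O, X.Nonempty → (∀ x ∈ X, ∀ y ∈ O, G.Adj x y → y ∈ X) → X = O
  min : ∀ S' F', TwoMatching G S' → OddFamily (G.deleteEdges {s(u, v)}) S' F' →
    S'.card ≤ F'.card + 3 → S.card ≤ S'.card

namespace Config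

variable {u v : V} {S : Finset V} {F : Finset (Finset V)} {A B : Finset V}

theorem symm (h : Config G u v S F A B) : Config G v u S F B A where
  adj := h.adj.symm
  two := h.two
  card := h.card
  fam := by rw [Sym2.eq_swap]; exact h.fam
  memA := h.memB
  memB := h.memA
  ne := h.ne.symm
  hu := h.hv
  hv := h.hu
  conn := h.conn
  min := by rw [Sym2.eq_swap]; exact h.min

theorem closed (h : Config G u v S F A B) {O : Finset V} (hO : O ∈ F) {x y : V} (hx : x ∈ O)
    (hxy : G.Adj x y) : y ∈ O ∨ y ∈ S ∨ (x = u ∧ y = v) ∨ (x = v ∧ y = u) := by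
  by_contra! hne
  have := h.fam.closed O hO x hx y (hxy.deleteEdges_of_ne hne.2.2.1 hne.2.2.2)
  grind

theorem eqA (h : Config G u v S F A B) {O : Finset V} (hO : O ∈ F) (hu : u ∈ O) : O = A :=
  h.fam.disj O hO A h.memA u hu h.hu

theorem eqB (h : Config G u v S F A B) {O : Finset V} (hO : O ∈ F) (hv : v ∈ O) : O = B :=
  h.symm.eqA hO hv

theorem not_adj (h : Config G u v S F A B) {O O' : Finset V} (hO : O ∈ F) (hO' : O' ∈ F)
    (hne : O ≠ O') {x y : V} (hx : x ∈ O) (hy : y ∈ O') (hxy : G.Adj x y) :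
    (x = u ∧ y = v) ∨ (x = v ∧ y = u) := by
  have h1 := h.closed hO hx hxy
  have h2 := h.fam.notMem O' hO' y hy
  have h3 := h.fam.disj O hO O' hO' y
  grind

theorem notMem_of_mem (h : Config G u v S F A B) {O O' : Finset V} (hO : O ∈ F) (hO' : O' ∈ F)
    (hne : O ≠ O') {x : V} (hx : x ∈ O) : x ∉ O' :=
  fun hx' => hne (h.fam.disj O hO O' hO' x hx hx')

/-- A vertex of `S` missed by some 2-matching of `G[S]` is adjacent to both `u` and `v`, and
its other neighbours outside `S` form a clique inside a single odd component. -/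
theorem special (h : Config G u v S F A B) (hclaw : ClawFree G) {w : V} (hw : w ∈ S)
    (hM : TwoMatching G (S.erase w)) :
    G.Adj u w ∧ G.Adj v w ∧ ∃ O ∈ F, O ≠ A ∧ O ≠ B ∧ (∃ y ∈ O, G.Adj w y) ∧
      (∀ y, G.Adj w y → y ∈ S ∨ y = u ∨ y = v ∨ y ∈ O) ∧
      ∀ y ∈ O, ∀ y' ∈ O, G.Adj w y → G.Adj w y' → y ≠ y' → G.Adj y y' := by
  classical
  set J := F.filter (fun O => ∃ x ∈ O, G.Adj w x) with hJ
  have hJ3 : 2 < J.card := by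
    by_contra! hlt
    have h1 : OddFamily (G.deleteEdges {s(u, v)}) (S.erase w) (F \ J) := by
      have h' := h.fam.mono (F' := F \ J) Finset.sdiff_subset
      refine ⟨h'.odd, h'.disj, fun O hO x hx => by have := h'.notMem O hO x hx; grind,
        fun O hO x hx y hxy => ?_⟩
      have h2 := h'.closed O hO x hx y hxy
      have h3 : G.Adj y x := ((deleteEdges_adj ..).1 hxy).1.symm
      have h4 : ¬ ∃ x ∈ O, G.Adj w x := by grind
      grind
    have h2 := h.min _ _ hM h1
    have h3 := h.card
    have h4 := Finset.le_card_sdiff J F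
    rw [Finset.card_erase_of_mem hw] at h2
    have h5 := Finset.card_pos.2 ⟨w, hw⟩
    omega
  have hcl : ∀ x y z, G.Adj w x → G.Adj w y → G.Adj w z → x ≠ y → x ≠ z → y ≠ z →
    ¬ G.Adj x y → ¬ G.Adj x z → ¬ G.Adj y z → False := hclaw w
  have key : G.Adj u w ∧ G.Adj v w ∧ ∃ O ∈ F, O ≠ A ∧ O ≠ B ∧ ∃ y ∈ O, G.Adj w y := by
    obtain ⟨O₁, O₂, O₃, h1, h2, h3, h12, h13, h23⟩ := Finset.two_lt_card_iff.1 hJ3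
    simp only [hJ, Finset.mem_filter] at h1 h2 h3
    obtain ⟨h1, x, hx, hwx⟩ := h1
    obtain ⟨h2, y, hy, hwy⟩ := h2
    obtain ⟨h3, z, hz, hwz⟩ := h3
    have a1 := h.not_adj h1 h2 h12 hx hy
    have a2 := h.not_adj h1 h3 h13 hx hz
    have a3 := h.not_adj h2 h3 h23 hy hz
    have b1 := h.notMem_of_mem h1 h2 h12 hx
    have b2 := h.notMem_of_mem h1 h3 h13 hx
    have b3 := h.notMem_of_mem h2 h3 h23 hy
    have c := hcl x y z hwx hwy hwz (by grind) (by grind) (by grind)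
    have hA := h.hu
    have hB := h.hv
    have hwx' := hwx.symm
    have hwy' := hwy.symm
    have hwz' := hwz.symm
    by_cases e1 : G.Adj x y
    · refine ⟨by grind, by grind, O₃, h3, ?_, ?_, z, hz, hwz⟩
      · rintro rfl; have := h.eqA h1; have := h.eqA h2; grind
      · rintro rfl; have := h.eqB h1; have := h.eqB h2; grind
    by_cases e2 : G.Adj x z
    · refine ⟨by grind, by grind, O₂, h2, ?_, ?_, y, hy, hwy⟩
      · rintro rfl; have := h.eqA h1; have := h.eqA h3; grind
      · rintro rfl; have := h.eqB h1; have := h.eqB h3; grind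
    by_cases e3 : G.Adj y z
    · refine ⟨by grind, by grind, O₁, h1, ?_, ?_, x, hx, hwx⟩
      · rintro rfl; have := h.eqA h2; have := h.eqA h3; grind
      · rintro rfl; have := h.eqB h2; have := h.eqB h3; grind
    exact (c e1 e2 e3).elim
  obtain ⟨hu, hv, O, hO, hOA, hOB, y, hy, hwy⟩ := key
  refine ⟨hu, hv, O, hO, hOA, hOB, ⟨y, hy, hwy⟩, fun z hwz => ?_, fun z hz z' hz' h1 h2 h3 => ?_⟩
  · by_contra! hz
    obtain ⟨hzS, hzu, hzv, hzO⟩ := hz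
    have a1 := h.closed hO hy (y := z)
    have a2 : y ≠ u := fun e => hOA (h.eqA hO (e ▸ hy))
    have a3 : y ≠ v := fun e => hOB (h.eqB hO (e ▸ hy))
    have a4 := h.not_adj h.memA hO hOA.symm h.hu hy
    have a5 := h.not_adj h.memB hO hOB.symm h.hv hy
    by_cases hzA : z ∈ A
    · have a6 := h.not_adj h.memB h.memA h.ne.symm h.hv hzA
      exact hcl v y z hv.symm hwy hwz a3.symm hzv.symm (by grind) (by grind) (by grind) (by grind)
    · have a6 := h.closed h.memA h.hu (y := z)
      exact hcl u y z hu.symm hwy hwz a2.symm hzu.symm (by grind) (by grind) (by grind) (by grind)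
  · by_contra h4
    have a4 := h.not_adj h.memA hO hOA.symm h.hu hz
    have a5 := h.not_adj h.memA hO hOA.symm h.hu hz'
    have := h.eqB hO
    have := h.eqA hO
    exact hcl u z z' hu.symm h1 h2 (by grind) (by grind) h3 (by grind) (by grind) h4

end Config

open scoped Classical in
/-- The vertices of `S` with a neighbour in `O`. -/
noncomputable def nbrsIn (G : SimpleGraph V) (S O : Finset V) : Finset V :=
  S.filter (fun y => ∃ x ∈ O, G.Adj x y)

theorem mem_nbrsIn {S O : Finset V} {y : V} :
    y ∈ nbrsIn G S O ↔ y ∈ S ∧ ∃ x ∈ O, G.Adj x y := by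
  classical
  simp [nbrsIn]

namespace Config

variable {u v : V} {S : Finset V} {F : Finset (Finset V)} {A B : Finset V}

theorem closed_of_ne (h : Config G u v S F A B) {O : Finset V} (hO : O ∈ F) (hA : O ≠ A)
    (hB : O ≠ B) {x y : V} (hx : x ∈ O) (hxy : G.Adj x y) : y ∈ O ∨ y ∈ nbrsIn G S O := by
  have h1 := h.closed hO hx hxy
  have h2 := h.eqA hO
  have h3 := h.eqB hO
  rw [mem_nbrsIn]
  grind

theorem nonempty (h : Config G u v S F A B) {O : Finset V} (hO : O ∈ F) : O.Nonempty :=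
  Finset.card_pos.1 (h.fam.odd O hO).pos

theorem u_notMem (h : Config G u v S F A B) : u ∉ S := h.fam.notMem A h.memA u h.hu

theorem three_le_card_nbrsIn (h : Config G u v S F A B) (hG : Ambient G) {O : Finset V}
    (hO : O ∈ F) (hA : O ≠ A) (hB : O ≠ B) : 3 ≤ (nbrsIn G S O).card :=
  hG.three_le_card_of_separates (h.nonempty hO)
    (fun _ hx _ hxy => h.closed_of_ne hO hA hB hx hxy)
    ⟨u, fun hu => hA (h.eqA hO hu), fun hu => h.u_notMem (mem_nbrsIn.1 hu).1⟩

/-- An odd component other than those of `u` and `v` is not cut off by two edges meeting it in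
all of its neighbours. -/
theorem not_separated (h : Config G u v S F A B) (hG : Ambient G) {O : Finset V}
    (hO : O ∈ F) (hA : O ≠ A) (hB : O ≠ B) {a b c d : V} (hab : G.Adj a b) (hcd : G.Adj c d)
    (h1 : a ≠ c) (h2 : a ≠ d) (h3 : b ≠ c) (h4 : b ≠ d)
    (ha : a ∉ O) (hb : b ∉ O) (hc : c ∉ O) (hd : d ∉ O)
    (hN : nbrsIn G S O ⊆ {a, b, c, d}) : False := by
  refine hG.not_odd_separated (h.fam.odd O hO) hab hcd h1 h2 h3 h4 ha hb hc hd
    fun x hx y hxy => ?_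
  have := h.closed_of_ne hO hA hB hx hxy
  grind

theorem exists_nbrsIn_not_adj (h : Config G u v S F A B) (hG : Ambient G) {O : Finset V}
    (hO : O ∈ F) (hA : O ≠ A) (hB : O ≠ B) (h3 : (nbrsIn G S O).card ≤ 3) :
    ∃ p ∈ nbrsIn G S O, ¬ G.Adj u p := by
  by_contra! hadj
  have h3' := h.three_le_card_nbrsIn hG hO hA hB
  obtain ⟨p, q, r, hpq, hpr, hqr, hP⟩ := Finset.card_eq_three.1 (le_antisymm h3 h3')
  have hu : u ∉ O := fun hu => hA (h.eqA hO hu)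
  have huS := h.u_notMem
  have hPO : ∀ p ∈ nbrsIn G S O, p ∉ O ∧ p ≠ u := fun p hp =>
    ⟨fun hp' => h.fam.notMem O hO p hp' (mem_nbrsIn.1 hp).1,
      fun e => huS (e ▸ (mem_nbrsIn.1 hp).1)⟩
  have aux : ∀ p q r, p ≠ r → q ≠ r → nbrsIn G S O = {p, q, r} → ¬ G.Adj p q := by
    intro p q r hpr hqr hP hpq
    rw [hP] at hadj hPO
    have hp := hPO p (by simp)
    have hq := hPO q (by simp)
    have hr := hPO r (by simp)
    exact h.not_separated hG hO hA hB hpq (hadj r (by simp)) hp.2 hpr hq.2 hqr hp.1 hq.1 hu hr.1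
      (by rw [hP]; grind)
  have hp := hadj p (by simp [hP])
  have hq := hadj q (by simp [hP])
  have hr := hadj r (by simp [hP])
  exact hG.claw u p q r hp hq hr hpq hpr hqr (aux p q r hpr hqr hP)
    (aux p r q hpq hqr.symm (by rw [hP]; grind))
    (aux q r p hpq.symm hpr.symm (by rw [hP]; grind))

theorem eq_singleton (h : Config G u v S F A B) (hu : ∀ x ∈ A, ¬ G.Adj u x) : A = {u} := by
  refine (h.conn A h.memA {u} (by simpa using h.hu) ⟨u, by simp⟩ fun x hx y hy hxy => ?_).symm
  rw [Finset.mem_singleton.1 hx] at hxy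
  exact (hu y hy hxy).elim

theorem mem_of_adj_of_eq_singleton (h : Config G u v S F A B) (hA : A = {u}) {y : V}
    (hy : G.Adj u y) : y ∈ insert v S := by
  have := h.closed h.memA h.hu hy
  have := hy.ne
  grind

theorem five_le_of_eq_singleton (h : Config G u v S F A B) (hG : Ambient G) (hA : A = {u}) :
    5 ≤ S.card := by
  have := hG.deg u _ fun y => h.mem_of_adj_of_eq_singleton hA
  have := Finset.card_insert_le v S
  omega

theorem twoMatching_card {a b c d : V} (hab : G.Adj a b) (hcd : G.Adj c d)
    (h1 : a ≠ c) (h2 : a ≠ d) (h3 : b ≠ c) (h4 : b ≠ d) : ({a, b, c, d} : Finset V).card = 4 := by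
  have := hab.ne
  have := hcd.ne
  rw [Finset.card_insert_of_notMem, Finset.card_insert_of_notMem, Finset.card_pair] <;> grind

theorem not_threeMatching (h : Config G u v S F A B) (hG : Ambient G) {a b c d e f : V}
    (hab : G.Adj a b) (hcd : G.Adj c d) (hef : G.Adj e f) (hnd : [a, b, c, d, e, f].Nodup)
    (hS : [a, b, c, d, e, f].toFinset ⊆ S) : False := by
  have hcard := Finset.card_le_card hS
  rw [List.toFinset_card_of_nodup hnd] at hcard
  simp only [List.length_cons, List.length_nil] at hcard
  have hsp : ∀ w ∈ S, TwoMatching G (S.erase w) := by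
    intro w hw
    simp only [List.toFinset_cons, List.toFinset_nil, Finset.insert_subset_iff] at hS
    simp only [List.nodup_cons, List.mem_cons, List.not_mem_nil] at hnd
    by_cases h1 : w = a ∨ w = b
    · exact ⟨c, d, e, f, by grind⟩
    by_cases h2 : w = c ∨ w = d
    · exact ⟨a, b, e, f, by grind⟩
    · exact ⟨a, b, c, d, by grind⟩
  have h4 : ∀ O ∈ (F.erase A).erase B, 4 ≤ (nbrsIn G S O).card := by
    intro O hO
    by_contra! hlt
    obtain ⟨p, hp, hup⟩ := h.exists_nbrsIn_not_adj hG (O := O) (by grind) (by grind) (by grind)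
      (by omega)
    have hpS := (mem_nbrsIn.1 hp).1
    exact hup (h.special hG.claw hpS (hsp p hpS)).1
  have hle : ((F.erase A).erase B).card * 4 ≤ S.card := by
    have h5 := Finset.card_nsmul_le_sum _ _ _ h4
    rw [← Finset.card_biUnion] at h5
    · refine h5.trans (Finset.card_le_card ?_)
      intro y hy
      obtain ⟨O, -, hy⟩ := Finset.mem_biUnion.1 hy
      exact (mem_nbrsIn.1 hy).1
    · intro O hO O' hO' hne
      rw [Function.onFun, Finset.disjoint_left]
      intro y hy hy'
      obtain ⟨hyS, x, hx, hxy⟩ := mem_nbrsIn.1 hy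
      obtain ⟨-, x', hx', hxy'⟩ := mem_nbrsIn.1 hy'
      obtain ⟨-, -, Q, hQ, -, -, -, hcl, -⟩ := h.special hG.claw hyS (hsp y hyS)
      have key : ∀ O ∈ (F.erase A).erase B, ∀ x ∈ O, G.Adj y x → O = Q := by
        intro O hO x hx hyx
        simp only [Finset.mem_erase] at hO
        have h6 := hcl x hyx
        have h7 := h.eqA hO.2.2
        have h8 := h.eqB hO.2.2
        have h9 := h.fam.notMem O hO.2.2 x hx
        have h10 := h.fam.disj O hO.2.2 Q hQ x hx
        grind
      exact hne ((key O hO x hx hxy.symm).trans (key O' hO' x' hx' hxy'.symm).symm)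
  have hBA : B ∈ F.erase A := Finset.mem_erase.2 ⟨h.ne.symm, h.memB⟩
  rw [Finset.card_erase_of_mem hBA, Finset.card_erase_of_mem h.memA] at hle
  have := h.card
  omega

/-- The vertices missed by a 2-matching of `G[S]` are pairwise nonadjacent. -/
theorem not_adj_of_missed (h : Config G u v S F A B) (hG : Ambient G) {a b c d x y : V}
    (hab : G.Adj a b) (hcd : G.Adj c d)
    (h1 : a ≠ c) (h2 : a ≠ d) (h3 : b ≠ c) (h4 : b ≠ d)
    (hS : {a, b, c, d} ⊆ S) (hx : x ∈ S \ {a, b, c, d}) (hy : y ∈ S \ {a, b, c, d}) :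
    ¬ G.Adj x y := by
  intro hxy
  have := hab.ne
  have := hcd.ne
  have := hxy.ne
  refine h.not_threeMatching hG hab hcd hxy ?_ ?_
  · simp only [List.nodup_cons, List.mem_cons, List.not_mem_nil]
    grind
  · simp only [List.toFinset_cons, List.toFinset_nil]
    grind

theorem card_le_six (h : Config G u v S F A B) (hG : Ambient G) : S.card ≤ 6 := by
  by_contra! hlt
  obtain ⟨a, b, c, d, ha, hb, hc, hd, hab, hcd, h1, h2, h3, h4⟩ := h.two
  have h5 := Finset.le_card_sdiff {a, b, c, d} S
  rw [twoMatching_card hab hcd h1 h2 h3 h4] at h5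
  have hsub : {a, b, c, d} ⊆ S := by grind
  obtain ⟨x, y, z, hx, hy, hz, hxy, hxz, hyz⟩ :=
    Finset.two_lt_card_iff.1 (by omega : 2 < (S \ {a, b, c, d}).card)
  have hsp : ∀ w ∈ S \ {a, b, c, d}, G.Adj u w := fun w hw =>
    (h.special hG.claw (by grind) ⟨a, b, c, d, by grind⟩).1
  have hno := fun x y => h.not_adj_of_missed (x := x) (y := y) hG hab hcd h1 h2 h3 h4 hsub
  exact hG.claw u x y z (hsp x hx) (hsp y hy) (hsp z hz) hxy hxz hyz
    (hno x y hx hy) (hno x z hx hz) (hno y z hy hz)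

end Config

namespace Config
variable {u v : V} {S : Finset V} {F : Finset (Finset V)} {A B : Finset V}

theorem card_ne_six_aux (h : Config G u v S F A B) (hG : Ambient G) {O₃ O₄ : Finset V}
    (h3 : O₃ ∈ F) (h3A : O₃ ≠ A) (h3B : O₃ ≠ B) (h4 : O₄ ∈ F) (h4A : O₄ ≠ A) (h4B : O₄ ≠ B)
    (h34 : O₃ ≠ O₄) (hP : (nbrsIn G S O₃).card ≤ 3) (hQ : (nbrsIn G S O₄).card ≤ 4) {x b : V}
    (hx3 : x ∈ nbrsIn G S O₃) (hx4 : x ∈ nbrsIn G S O₄) (hu : ∀ y ∈ S, y ≠ x → G.Adj u y)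
    (hb : b ∈ S) (hxb : G.Adj x b)
    (hPQ : ∀ y, y ∈ nbrsIn G S O₃ → y ∈ nbrsIn G S O₄ → y = x) : False := by
  have huS := h.u_notMem
  have hxS := (mem_nbrsIn.1 hx3).1
  have hbx := hxb.ne'
  have key : ∀ O ∈ F, O ≠ A → O ≠ B → x ∈ nbrsIn G S O → (nbrsIn G S O).card ≤ 3 →
      b ∉ nbrsIn G S O := by
    intro O hO hA hB hx h3 hbO
    have h5 := h.three_le_card_nbrsIn hG hO hA hB
    have h6 : b ∈ (nbrsIn G S O).erase x := Finset.mem_erase.2 ⟨hbx, hbO⟩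
    have h7 : (((nbrsIn G S O).erase x).erase b).card = 1 := by
      rw [Finset.card_erase_of_mem h6, Finset.card_erase_of_mem hx]
      omega
    obtain ⟨q, hq⟩ := Finset.card_eq_one.1 h7
    have hq' : q ∈ ((nbrsIn G S O).erase x).erase b := by simp [hq]
    simp only [Finset.mem_erase] at hq'
    have hqS := (mem_nbrsIn.1 hq'.2.2).1
    have hnot := fun y hy => h.fam.notMem O hO y hy
    have := h.eqA hO
    exact h.not_separated hG hO hA hB hxb (hu q hqS hq'.2.1) (by grind) (by grind) (by grind)
      (by grind) (by grind) (by grind) (by grind) (by grind) (by grind)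
  have hbP := key O₃ h3 h3A h3B hx3 hP
  obtain ⟨-, y₃, hy₃, hxy₃⟩ := mem_nbrsIn.1 hx3
  obtain ⟨-, y₄, hy₄, hxy₄⟩ := mem_nbrsIn.1 hx4
  have hnot3 := fun y hy => h.fam.notMem O₃ h3 y hy
  have hnot4 := fun y hy => h.fam.notMem O₄ h4 y hy
  have a34 := h.not_adj h3 h4 h34 hy₃ hy₄
  have a34' := h.notMem_of_mem h3 h4 h34 hy₃
  have hu3 : u ∉ O₃ := fun e => h3A (h.eqA h3 e)
  have hu4 : u ∉ O₄ := fun e => h4A (h.eqA h4 e)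
  have hbQ : b ∈ nbrsIn G S O₄ := by
    by_contra hbQ
    exact hG.claw x y₃ y₄ b hxy₃.symm hxy₄.symm hxb (by grind) (by grind) (by grind)
      (by grind) (fun e => hbP (mem_nbrsIn.2 ⟨hb, _, hy₃, e⟩))
      (fun e => hbQ (mem_nbrsIn.2 ⟨hb, _, hy₄, e⟩))
  have hQ4 : (nbrsIn G S O₄).card = 4 := by
    by_contra hne
    exact key O₄ h4 h4A h4B hx4 (by omega) hbQ
  have hP3 := h.three_le_card_nbrsIn hG h3 h3A h3B
  obtain ⟨p, q, hpq, hPe⟩ := Finset.card_eq_two.1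
    (by rw [Finset.card_erase_of_mem hx3]; omega : ((nbrsIn G S O₃).erase x).card = 2)
  obtain ⟨r, s, hrs, hQe⟩ := Finset.card_eq_two.1
    (by rw [Finset.card_erase_of_mem (Finset.mem_erase.2 ⟨hbx, hbQ⟩),
      Finset.card_erase_of_mem hx4]; omega : (((nbrsIn G S O₄).erase x).erase b).card = 2)
  have hp : p ∈ (nbrsIn G S O₃).erase x := by simp [hPe]
  have hq : q ∈ (nbrsIn G S O₃).erase x := by simp [hPe]
  have hr : r ∈ ((nbrsIn G S O₄).erase x).erase b := by simp [hQe]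
  have hs : s ∈ ((nbrsIn G S O₄).erase x).erase b := by simp [hQe]
  simp only [Finset.mem_erase] at hp hq hr hs
  have hpS := (mem_nbrsIn.1 hp.2).1
  have hqS := (mem_nbrsIn.1 hq.2).1
  have hrS := (mem_nbrsIn.1 hr.2.2).1
  have hsS := (mem_nbrsIn.1 hs.2.2).1
  have hup := hu p hpS hp.1
  have huq := hu q hqS hq.1
  have hur := hu r hrS hr.2.1
  have hus := hu s hsS hs.2.1
  have hpr : p ≠ r := by grind
  have hps : p ≠ s := by grind
  have hqr : q ≠ r := by grind
  have hqs : q ≠ s := by grind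
  have hpb : p ≠ b := by grind
  have hqb : q ≠ b := by grind
  have hPsub : nbrsIn G S O₃ ⊆ {p, q, x, b} := by
    intro y hy
    by_cases hyx : y = x
    · simp [hyx]
    have hy' : y ∈ (nbrsIn G S O₃).erase x := by simp [hyx, hy]
    rw [hPe] at hy'
    grind
  have npq : ¬ G.Adj p q := fun e => h.not_separated hG h3 h3A h3B e hxb hp.1 hpb
    hq.1 hqb (by grind) (by grind) (by grind) (by grind) hPsub
  have hQsub : nbrsIn G S O₄ ⊆ {r, s, x, b} := by
    intro y hy
    by_cases hyx : y = x
    · simp [hyx]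
    by_cases hyb : y = b
    · simp [hyb]
    have hy' : y ∈ ((nbrsIn G S O₄).erase x).erase b := by simp [hyx, hyb, hy]
    rw [hQe] at hy'
    grind
  have nrs : ¬ G.Adj r s := fun e => h.not_separated hG h4 h4A h4B e hxb hr.2.1 hr.1
    hs.2.1 hs.1 (by grind) (by grind) (by grind) (by grind) hQsub
  have c1 := hG.claw u p q r hup huq hur hpq hpr hqr npq
  have c2 := hG.claw u p q s hup huq hus hpq hps hqs npq
  have c3 := hG.claw u r s p hur hus hup hrs hpr.symm hps.symm nrs
  have c4 := hG.claw u r s q hur hus huq hrs hqr.symm hqs.symm nrs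
  have three : ∀ p q r s, p ∈ S → q ∈ S → r ∈ S → s ∈ S → G.Adj p r → G.Adj q s →
      [p, r, q, s, x, b].Nodup → False := by
    intro p q r s hp hq hr hs hpr hqs hnd
    refine h.not_threeMatching hG hpr hqs hxb hnd ?_
    simp [Finset.insert_subset_iff, *]
  have t1 := three p q r s hpS hqS hrS hsS
  have t2 := three p q s r hpS hqS hsS hrS
  simp only [List.nodup_cons, List.mem_cons, List.not_mem_nil, List.nodup_nil] at t1 t2
  by_cases e1 : G.Adj p r
  · by_cases e2 : G.Adj q s
    · exact t1 e1 e2 (by grind)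
    · exact t2 (by_contra fun e => c2 e e2) (by_contra fun e => c4 (e ∘ .symm) (e2 ∘ .symm))
        (by grind)
  · exact t2 (by_contra fun e => c3 (e1 ∘ .symm) (e ∘ .symm)) (by_contra fun e => c1 e1 e)
      (by grind)

theorem not_adj_of_special (h : Config G u v S F A B) (hG : Ambient G) {w x : V} (hw : w ∈ S)
    (hM : TwoMatching G (S.erase w)) (hx : x ∈ A) (hxu : x ≠ u) : ¬ G.Adj w x := by
  intro hwx
  obtain ⟨-, -, O, hO, hOA, -, -, hcl, -⟩ := h.special hG.claw hw hM
  have h5 := hcl x hwx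
  have h6 := h.fam.notMem A h.memA x hx
  have h7 := h.notMem_of_mem h.memA hO hOA.symm hx
  have h8 := h.notMem_of_mem h.memA h.memB h.ne hx
  have h9 := h.hv
  grind

theorem card_ne_six (h : Config G u v S F A B) (hG : Ambient G) : S.card ≠ 6 := by
  intro h6
  obtain ⟨a, b, c, d, ha, hb, hc, hd, hab, hcd, h1, h2, h3, h4⟩ := h.two
  have hsub : {a, b, c, d} ⊆ S := by grind
  have hU : (S \ {a, b, c, d}).card = 2 := by
    rw [Finset.card_sdiff_of_subset hsub, twoMatching_card hab hcd h1 h2 h3 h4, h6]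
  obtain ⟨w, w', hww, hU⟩ := Finset.card_eq_two.1 hU
  have hw : w ∈ S \ {a, b, c, d} := by simp [hU]
  have hw' : w' ∈ S \ {a, b, c, d} := by simp [hU]
  have hsp : ∀ w ∈ S \ {a, b, c, d}, _ := fun w hw =>
    h.special hG.claw (w := w) (by grind) ⟨a, b, c, d, by grind⟩
  have hno := h.not_adj_of_missed hG hab hcd h1 h2 h3 h4 hsub hw hw'
  have hwA : ∀ w ∈ S \ {a, b, c, d}, ∀ x ∈ A, x ≠ u → ¬ G.Adj w x := by
    intro w hw x hx hxu hwx
    exact h.not_adj_of_special hG (by grind) ⟨a, b, c, d, by grind⟩ hx hxu hwx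
  have hA : A = {u} := by
    refine h.eq_singleton fun x hx hux => ?_
    have := h.fam.notMem A h.memA x hx
    exact hG.claw u w w' x (hsp w hw).1 (hsp w' hw').1 hux hww (by grind) (by grind) hno
      (hwA w hw x hx hux.ne') (hwA w' hw' x hx hux.ne')
  have huniq : ∀ x ∈ S, ¬ G.Adj u x → ∀ y ∈ S, y ≠ x → G.Adj u y := by
    intro x hx hux y hy hyx
    by_contra huy
    obtain ⟨z, huz, hz⟩ := hG.exists_adj_notMem u (T := insert v ((S.erase x).erase y)) <| by
      refine (Finset.card_insert_le _ _).trans ?_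
      rw [Finset.card_erase_of_mem (by grind), Finset.card_erase_of_mem hx]
      omega
    have hzx : z ≠ x := fun e => hux (e ▸ huz)
    have hzy : z ≠ y := fun e => huy (e ▸ huz)
    have := h.mem_of_adj_of_eq_singleton hA huz
    simp_all
  have hBA : B ∈ F.erase A := Finset.mem_erase.2 ⟨h.ne.symm, h.memB⟩
  obtain ⟨O₃, O₄, h34, hF⟩ := Finset.card_eq_two.1
    (by rw [Finset.card_erase_of_mem hBA, Finset.card_erase_of_mem h.memA]
        have := h.card
        omega : ((F.erase A).erase B).card = 2)
  have h3F : O₃ ∈ (F.erase A).erase B := by simp [hF]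
  have h4F : O₄ ∈ (F.erase A).erase B := by simp [hF]
  simp only [Finset.mem_erase] at h3F h4F
  have hPQu : ∀ x, x ∈ nbrsIn G S O₃ → x ∈ nbrsIn G S O₄ → ¬ G.Adj u x := by
    intro x hx3 hx4 hux
    obtain ⟨-, y₃, hy₃, hxy₃⟩ := mem_nbrsIn.1 hx3
    obtain ⟨-, y₄, hy₄, hxy₄⟩ := mem_nbrsIn.1 hx4
    have a1 := h.not_adj h3F.2.2 h4F.2.2 h34 hy₃ hy₄
    have a2 := h.notMem_of_mem h3F.2.2 h4F.2.2 h34 hy₃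
    have a3 := h.not_adj h.memA h3F.2.2 h3F.2.1.symm h.hu hy₃
    have a4 := h.not_adj h.memA h4F.2.2 h4F.2.1.symm h.hu hy₄
    have a5 := h.eqA h3F.2.2
    have a6 := h.eqA h4F.2.2
    have a7 := h.eqB h3F.2.2
    have a8 := h.eqB h4F.2.2
    exact hG.claw x u y₃ y₄ hux.symm hxy₃.symm hxy₄.symm (by grind) (by grind) (by grind)
      (by grind) (by grind) (by grind)
  have hle : (nbrsIn G S O₃).card + (nbrsIn G S O₄).card =
      (nbrsIn G S O₃ ∪ nbrsIn G S O₄).card + (nbrsIn G S O₃ ∩ nbrsIn G S O₄).card :=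
    (Finset.card_union_add_card_inter _ _).symm
  have hle1 : (nbrsIn G S O₃ ∪ nbrsIn G S O₄).card ≤ 6 := by
    rw [← h6]
    refine Finset.card_le_card fun y hy => ?_
    rcases Finset.mem_union.1 hy with hy | hy <;> exact (mem_nbrsIn.1 hy).1
  have hle2 : (nbrsIn G S O₃ ∩ nbrsIn G S O₄).card ≤ 1 := by
    rw [Finset.card_le_one]
    intro x hx y hy
    rw [Finset.mem_inter] at hx hy
    by_contra hne
    exact hPQu y hy.1 hy.2 (huniq x (mem_nbrsIn.1 hx.1).1 (hPQu x hx.1 hx.2) y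
      (mem_nbrsIn.1 hy.1).1 (Ne.symm hne))
  have h3c := h.three_le_card_nbrsIn hG h3F.2.2 h3F.2.1 h3F.1
  have h4c := h.three_le_card_nbrsIn hG h4F.2.2 h4F.2.1 h4F.1
  obtain ⟨x, hx3, hx4, hux⟩ : ∃ x, x ∈ nbrsIn G S O₃ ∧ x ∈ nbrsIn G S O₄ ∧ ¬ G.Adj u x := by
    rcases (nbrsIn G S O₃ ∩ nbrsIn G S O₄).eq_empty_or_nonempty with he | ⟨x, hx⟩
    · rw [he, Finset.card_empty] at hle
      obtain ⟨x, hx, hux⟩ := h.exists_nbrsIn_not_adj hG h3F.2.2 h3F.2.1 h3F.1 (by omega)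
      obtain ⟨y, hy, huy⟩ := h.exists_nbrsIn_not_adj hG h4F.2.2 h4F.2.1 h4F.1 (by omega)
      have := huniq x (mem_nbrsIn.1 hx).1 hux y (mem_nbrsIn.1 hy).1
      exact ⟨x, hx, by grind, hux⟩
    · rw [Finset.mem_inter] at hx
      exact ⟨x, hx.1, hx.2, hPQu x hx.1 hx.2⟩
  have hxS := (mem_nbrsIn.1 hx3).1
  obtain ⟨b', hb', hxb'⟩ : ∃ b' ∈ S, G.Adj x b' := by
    have h7 : x ∈ ({a, b, c, d} : Finset V) := by
      by_contra h7
      exact hux (hsp x (Finset.mem_sdiff.2 ⟨hxS, h7⟩)).1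
    simp only [Finset.mem_insert, Finset.mem_singleton] at h7
    rcases h7 with rfl | rfl | rfl | rfl
    exacts [⟨b, hb, hab⟩, ⟨a, ha, hab.symm⟩, ⟨d, hd, hcd⟩, ⟨c, hc, hcd.symm⟩]
  have hu := huniq x hxS hux
  have hPQ : ∀ y, y ∈ nbrsIn G S O₃ → y ∈ nbrsIn G S O₄ → y = x := by
    intro y hy3 hy4
    by_contra hne
    exact hPQu y hy3 hy4 (hu y (mem_nbrsIn.1 hy3).1 hne)
  by_cases h3' : (nbrsIn G S O₃).card ≤ 3
  · exact h.card_ne_six_aux hG h3F.2.2 h3F.2.1 h3F.1 h4F.2.2 h4F.2.1 h4F.1 h34 h3' (by omega)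
      hx3 hx4 hu hb' hxb' hPQ
  · exact h.card_ne_six_aux hG h4F.2.2 h4F.2.1 h4F.1 h3F.2.2 h3F.2.1 h3F.1 h34.symm (by omega)
      (by omega) hx4 hx3 hu hb' hxb' fun y h3 h4 => hPQ y h4 h3

theorem four_le_card (h : Config G u v S F A B) : 4 ≤ S.card := by
  obtain ⟨a, b, c, d, ha, hb, hc, hd, hab, hcd, h1, h2, h3, h4⟩ := h.two
  rw [← twoMatching_card hab hcd h1 h2 h3 h4]
  exact Finset.card_le_card (by grind)

theorem card_eq_four_or_five (h : Config G u v S F A B) (hG : Ambient G) :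
    S.card = 4 ∨ S.card = 5 := by
  have := h.four_le_card
  have := h.card_le_six hG
  have := h.card_ne_six hG
  omega

theorem one_lt_card_of_ne_singleton (h : Config G u v S F A B) (hA : A ≠ {u}) :
    1 < A.card := by
  by_contra! hle
  obtain ⟨x, rfl⟩ := Finset.card_eq_one.1 (le_antisymm hle (h.fam.odd A h.memA).pos)
  have := h.hu
  rw [Finset.mem_singleton] at this
  exact hA (by rw [this])

theorem one_lt_card_of_card_eq_four (h : Config G u v S F A B) (hG : Ambient G)
    (h4 : S.card = 4) : 1 < A.card := by
  refine h.one_lt_card_of_ne_singleton fun hA => ?_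
  have := h.five_le_of_eq_singleton hG hA
  omega

end Config

theorem Finset.odd_card_erase {X : Finset V} (hX : Even X.card) {x : V} (hx : x ∈ X) :
    Odd (X.erase x).card := by
  rw [Finset.card_erase_of_mem hx]
  exact Nat.Even.sub_odd (Finset.card_pos.2 ⟨x, hx⟩) hX odd_one

theorem Finset.even_card_erase {X : Finset V} (hX : Odd X.card) {x : V} (hx : x ∈ X) :
    Even (X.erase x).card := by
  rw [Finset.card_erase_of_mem hx]
  exact Nat.Odd.sub_odd hX odd_one

namespace Config
variable {u v : V} {S : Finset V} {F : Finset (Finset V)} {A B : Finset V}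

theorem not_adj_missed_aux (h : Config G u v S F A B) (hG : Ambient G) {w a b c d : V}
    (hS : S = {w, a, b, c, d}) (hab : G.Adj a b) (hcd : G.Adj c d)
    (h1 : a ≠ c) (h2 : a ≠ d) (h3 : b ≠ c) (h4 : b ≠ d)
    (hw : w ∉ ({a, b, c, d} : Finset V)) (hA : 1 < A.card) (hwa : G.Adj w a) : False := by
  have hab' := hab.ne
  have hcd' := hcd.ne
  have hwS : w ∈ S := by simp [hS]
  have haS : a ∈ S := by simp [hS]
  have hbS : b ∈ S := by simp [hS]
  have hcS : c ∈ S := by simp [hS]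
  have hdS : d ∈ S := by simp [hS]
  simp only [Finset.mem_insert, Finset.mem_singleton, not_or] at hw
  obtain ⟨hwa', hwb', hwc', hwd'⟩ := hw
  have nw : ∀ x ∈ A, x ≠ u → ¬ G.Adj w x := fun x =>
    h.not_adj_of_special hG hwS ⟨a, b, c, d, by grind⟩
  have nb : ∀ x ∈ A, x ≠ u → ¬ G.Adj b x := fun x =>
    h.not_adj_of_special hG hbS ⟨w, a, c, d, by grind⟩
  have na : ∀ x ∈ A, x ≠ u → ¬ G.Adj a x := by
    intro x hx hxu hax
    have hxS := h.fam.notMem A h.memA x hx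
    by_cases hwb : G.Adj w b
    · exact h.not_adj_of_special hG haS ⟨w, b, c, d, by grind⟩ hx hxu hax
    · exact hG.claw a x w b hax hwa.symm hab (by grind) (by grind) hwb'
        (fun e => nw x hx hxu e.symm) (fun e => nb x hx hxu e.symm) hwb
  have hcl : ∀ x ∈ A.erase u, ∀ y, G.Adj x y →
      y ∈ A.erase u ∨ y ∈ ({c, d} : Finset V) ∨ y = u := by
    intro x hx y hxy
    rw [Finset.mem_erase] at hx
    have h5 := h.closed h.memA hx.2 hxy
    have h6 := h.notMem_of_mem h.memA h.memB h.ne hx.2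
    have h7 := h.hv
    have h8 := na x hx.2 hx.1
    have h9 := nb x hx.2 hx.1
    have h10 := nw x hx.2 hx.1
    have h11 := hxy.symm
    rw [hS] at h5
    simp only [Finset.mem_insert, Finset.mem_singleton, Finset.mem_erase] at h5 ⊢
    grind
  have huS := h.u_notMem
  have hne : (A.erase u).Nonempty := by
    rw [← Finset.card_pos, Finset.card_erase_of_mem h.hu]
    omega
  have haA : ∀ y ∈ S, y ∉ A := fun y hy hyA => h.fam.notMem A h.memA y hyA hy
  obtain ⟨x, hx, hxu⟩ : ∃ x ∈ A.erase u, G.Adj x u := by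
    by_contra! hno
    have := hG.three_le_card_of_separates (X := A.erase u) (C := {c, d}) hne
      (by grind) ⟨u, by simp, by grind⟩
    have : ({c, d} : Finset V).card ≤ 2 := Finset.card_le_two
    omega
  have hx' := Finset.mem_erase.1 hx
  have hxS := h.fam.notMem A h.memA x hx'.2
  exact hG.not_odd_separated
    (Finset.odd_card_erase (Finset.even_card_erase (h.fam.odd A h.memA) h.hu) hx) hxu hcd
    (by grind) (by grind) (by grind) (by grind) (by grind) (by grind) (by grind) (by grind)
    (by grind)

/-- If `|S| = 5` and `u` is not an isolated component, then a vertex missed by a 2-matching of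
`G[S]` is isolated in `G[S]`. -/
theorem not_adj_missed (h : Config G u v S F A B) (hG : Ambient G) (h5 : S.card = 5) {w : V}
    (hw : w ∈ S) (hM : TwoMatching G (S.erase w)) (hA : 1 < A.card) {x : V} (hx : x ∈ S) :
    ¬ G.Adj w x := by
  intro hwx
  obtain ⟨a, b, c, d, ha, hb, hc, hd, hab, hcd, h1, h2, h3, h4⟩ := hM
  have hT : {a, b, c, d} = S.erase w := by
    refine Finset.eq_of_subset_of_card_le (by grind) ?_
    rw [twoMatching_card hab hcd h1 h2 h3 h4, Finset.card_erase_of_mem hw, h5]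
  have hS : S = {w, a, b, c, d} := by rw [hT, Finset.insert_erase hw]
  have hw' : w ∉ ({a, b, c, d} : Finset V) := by simp [hT]
  have hxT : x ∈ ({a, b, c, d} : Finset V) := by
    rw [hT]
    exact Finset.mem_erase.2 ⟨hwx.ne', hx⟩
  simp only [Finset.mem_insert, Finset.mem_singleton] at hxT
  rcases hxT with rfl | rfl | rfl | rfl
  · exact h.not_adj_missed_aux hG hS hab hcd h1 h2 h3 h4 hw' hA hwx
  · exact h.not_adj_missed_aux hG (b := a) (by rw [hS]; grind) hab.symm hcd h3 h4 h1 h2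
      (by grind) hA hwx
  · exact h.not_adj_missed_aux hG (b := d) (c := a) (d := b) (by rw [hS]; grind) hcd hab h1.symm
      h3.symm h2.symm h4.symm (by grind) hA hwx
  · exact h.not_adj_missed_aux hG (b := c) (c := a) (d := b) (by rw [hS]; grind) hcd.symm hab
      h2.symm h4.symm h1.symm h3.symm (by grind) hA hwx

theorem exists_missed (h : Config G u v S F A B) (h5 : S.card = 5) :
    ∃ w ∈ S, TwoMatching G (S.erase w) := by
  obtain ⟨a, b, c, d, ha, hb, hc, hd, hab, hcd, h1, h2, h3, h4⟩ := h.two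
  obtain ⟨w, hw, hw'⟩ := Finset.exists_mem_notMem_of_card_lt_card
    (by rw [twoMatching_card hab hcd h1 h2 h3 h4]; omega : ({a, b, c, d} : Finset V).card < S.card)
  exact ⟨w, hw, a, b, c, d, by grind⟩

theorem mem_of_adj_of_adj (h : Config G u v S F A B) {z : V} (hu : G.Adj u z) (hv : G.Adj v z) :
    z ∈ S := by
  have h1 := h.closed h.memA h.hu hu
  have h2 := h.closed h.memB h.hv hv
  have h3 := h.notMem_of_mem h.memA h.memB h.ne (x := z)
  have := hu.ne
  have := hv.ne
  grind

theorem adj_of_eq_singleton (h : Config G u v S F A B) (hG : Ambient G) (h5 : S.card = 5)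
    (hA : A = {u}) {x : V} (hx : x ∈ S) : G.Adj u x := by
  by_contra hux
  obtain ⟨z, huz, hz⟩ := hG.exists_adj_notMem u (T := insert v (S.erase x)) <| by
    refine (Finset.card_insert_le _ _).trans ?_
    rw [Finset.card_erase_of_mem hx]
    omega
  have hzx : z ≠ x := fun e => hux (e ▸ huz)
  have := h.mem_of_adj_of_eq_singleton hA huz
  simp_all

/-- When `|S| = 5` and `u` is an isolated component, there are no even components. -/
theorem exists_mem_of_notMem (h : Config G u v S F A B) (hG : Ambient G) (h5 : S.card = 5)
    (hA : A = {u}) {z : V} (hz : z ∉ S) : ∃ O ∈ F, z ∈ O := by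
  classical
  by_contra! hzF
  set E : Finset V := Finset.univ.filter (fun z => z ∉ S ∧ ∀ O ∈ F, z ∉ O) with hE
  have hmem : ∀ x, x ∈ E ↔ x ∉ S ∧ ∀ O ∈ F, x ∉ O := by simp [hE]
  have hEcl : ∀ x ∈ E, ∀ y, G.Adj x y → y ∈ E ∨ y ∈ nbrsIn G S E := by
    intro x hx y hxy
    by_cases hy : y ∈ S
    · exact Or.inr (mem_nbrsIn.2 ⟨hy, x, hx, hxy⟩)
    refine Or.inl ((hmem y).2 ⟨hy, fun O hO hyO => ?_⟩)
    rw [hmem] at hx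
    have h1 := h.closed hO hyO hxy.symm
    have h2 := hx.2 O hO
    have h3 := hx.2 A h.memA
    have h4 := hx.2 B h.memB
    have h5 := h.hu
    have h6 := h.hv
    grind
  have hE3 := hG.three_le_card_of_separates ⟨z, (hmem z).2 ⟨hz, hzF⟩⟩ hEcl
    ⟨u, fun e => ((hmem u).1 e).2 A h.memA h.hu, fun e => h.u_notMem (mem_nbrsIn.1 e).1⟩
  have hBA : B ∈ F.erase A := Finset.mem_erase.2 ⟨h.ne.symm, h.memB⟩
  obtain ⟨O, hF⟩ := Finset.card_eq_one.1
    (by rw [Finset.card_erase_of_mem hBA, Finset.card_erase_of_mem h.memA]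
        have := h.card
        omega : ((F.erase A).erase B).card = 1)
  have hO : O ∈ (F.erase A).erase B := by simp [hF]
  simp only [Finset.mem_erase] at hO
  have hO3 := h.three_le_card_nbrsIn hG hO.2.2 hO.2.1 hO.1
  have hdisj : Disjoint (nbrsIn G S E) (nbrsIn G S O) := by
    rw [Finset.disjoint_left]
    intro x hx hx'
    obtain ⟨hxS, e, he, hex⟩ := mem_nbrsIn.1 hx
    obtain ⟨-, y, hy, hyx⟩ := mem_nbrsIn.1 hx'
    rw [hmem] at he
    have a1 := h.closed h.memA h.hu (y := e)
    have a2 := h.closed hO.2.2 hy (y := e)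
    have a3 := h.not_adj h.memA hO.2.2 hO.2.1.symm h.hu hy
    have a4 := h.eqA hO.2.2
    have a5 := h.eqB hO.2.2
    have a6 := he.2 A h.memA
    have a7 := he.2 B h.memB
    have a8 := he.2 O hO.2.2
    have a9 := h.hu
    have a10 := h.hv
    have a11 := h.ne
    exact hG.claw x u e y (h.adj_of_eq_singleton hG h5 hA hxS).symm hex.symm hyx.symm (by grind)
      (by grind) (by grind) (by grind) (by grind) (fun e => by have := a2 e.symm; grind)
  have h6 := Finset.card_le_card (s := nbrsIn G S E ∪ nbrsIn G S O) (t := S) (by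
    intro y hy
    rcases Finset.mem_union.1 hy with hy | hy <;> exact (mem_nbrsIn.1 hy).1)
  rw [Finset.card_union_of_disjoint hdisj] at h6
  omega

end Config

namespace Config
variable {u v : V} {S : Finset V} {F : Finset (Finset V)} {A B : Finset V}

theorem exists_adj_of_card_eq_four (h : Config G u v S F A B) (h4 : S.card = 4) {x : V}
    (hx : x ∈ S) : ∃ p ∈ S, G.Adj x p := by
  obtain ⟨a, b, c, d, ha, hb, hc, hd, hab, hcd, h1, h2, h3, h4'⟩ := h.two
  have hT : {a, b, c, d} = S := by
    refine Finset.eq_of_subset_of_card_le (by simp [Finset.insert_subset_iff, *]) ?_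
    rw [twoMatching_card hab hcd h1 h2 h3 h4', h4]
  rw [← hT] at hx
  simp only [Finset.mem_insert, Finset.mem_singleton] at hx
  rcases hx with rfl | rfl | rfl | rfl
  exacts [⟨b, hb, hab⟩, ⟨a, ha, hab.symm⟩, ⟨d, hd, hcd⟩, ⟨c, hc, hcd.symm⟩]

end Config

/-- A vertex `w` whose neighbourhood is the disjoint union of an edge `uv` and a clique `Y`,
without edges between `{u, v}` and `Y`. -/
structure Cap (G : SimpleGraph V) (u v w : V) (Y : Finset V) : Prop where
  huv : G.Adj u v
  nbr : ∀ y, G.Adj w y ↔ y = u ∨ y = v ∨ y ∈ Y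
  clique : ∀ y ∈ Y, ∀ y' ∈ Y, y ≠ y' → G.Adj y y'
  nu : ∀ y ∈ Y, ¬ G.Adj u y
  nv : ∀ y ∈ Y, ¬ G.Adj v y
  hu : u ∉ Y
  hv : v ∉ Y

/-- What a minimum separating set for an edge `wy` with `y ∈ Y` provides: `R` is the component
of `w`, without `w` itself, and `s` the only separating vertex outside `Y`. -/
structure Piece (G : SimpleGraph V) (u w : V) (Y : Finset V) (y s : V) (R : Finset V) : Prop where
  hu : u ∈ R
  notMem : ∀ x ∈ R, x ∉ Y ∧ x ≠ w ∧ x ≠ s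
  closed : ∀ x ∈ R, ∀ z, G.Adj x z → z ∈ R ∨ z = w ∨ z = s ∨ z ∈ Y
  nonadj : ∀ x ∈ R, ¬ G.Adj x y
  conn : ∀ X ⊆ R, u ∈ X → (∀ x ∈ X, ∀ z ∈ R, G.Adj x z → z ∈ X) → X = R
  exists_adj : ∃ y' ∈ Y, y' ≠ y ∧ G.Adj s y'
  one_le : 1 ≤ (nbrsIn G Y R).card
  le_two : (nbrsIn G Y R).card ≤ 2
  not_adj : (nbrsIn G Y R).card = 2 → ∀ y' ∈ Y, y' ≠ y → y' ∉ nbrsIn G Y R → ¬ G.Adj s y'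

theorem Piece.not_all {u w : V} {Y : Finset V} (hY : Y.Nonempty) {s : V → V} {R : V → Finset V}
    (h : ∀ y ∈ Y, Piece G u w Y y (s y) (R y)) : False := by
  have hsub : ∀ y ∈ Y, ∀ y' ∈ Y, s y' ∉ R y → R y ⊆ R y' := by
    intro y hy y' hy' hs
    rw [← Finset.inter_eq_left]
    refine (h y hy).conn _ Finset.inter_subset_left
      (Finset.mem_inter.2 ⟨(h y hy).hu, (h y' hy').hu⟩) fun x hx z hz hxz => ?_
    rw [Finset.mem_inter] at hx
    have h1 := (h y' hy').closed x hx.2 z hxz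
    have h2 := (h y hy).notMem z hz
    grind
  have htwo : ∀ y ∈ Y, (nbrsIn G Y (R y)).card = 2 := by
    intro y hy
    obtain ⟨y₁, hy₁⟩ := Finset.card_pos.1 (h y hy).one_le
    obtain ⟨hy₁Y, x, hx, hxy₁⟩ := mem_nbrsIn.1 hy₁
    have hs : s y₁ ∈ R y := by
      by_contra hs
      exact (h y₁ hy₁Y).nonadj x (hsub y hy y₁ hy₁Y hs hx) hxy₁
    obtain ⟨y₂, hy₂, hne, hadj⟩ := (h y₁ hy₁Y).exists_adj
    have h2 : y₂ ∈ nbrsIn G Y (R y) := mem_nbrsIn.2 ⟨hy₂, _, hs, hadj⟩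
    exact le_antisymm (h y hy).le_two (Finset.one_lt_card.2 ⟨y₂, h2, y₁, hy₁, hne⟩)
  obtain ⟨y, hy⟩ := hY
  obtain ⟨y', hy', hne, hadj⟩ := (h y hy).exists_adj
  have hmem : y' ∈ nbrsIn G Y (R y) := by
    by_contra hno
    exact (h y hy).not_adj (htwo y hy) y' hy' hne hno hadj
  have hs : s y ∉ R y' := fun hs => (h y' hy').nonadj _ hs hadj
  have hle : nbrsIn G Y (R y') ⊆ (nbrsIn G Y (R y)).erase y' := by
    intro z hz
    obtain ⟨hzY, x, hx, hxz⟩ := mem_nbrsIn.1 hz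
    refine Finset.mem_erase.2 ⟨?_, mem_nbrsIn.2 ⟨hzY, x, hsub y' hy' y hy hs hx, hxz⟩⟩
    rintro rfl
    exact (h z hy').nonadj x hx hxz
  have := Finset.card_le_card hle
  rw [Finset.card_erase_of_mem hmem, htwo y hy, htwo y' hy'] at this
  omega

namespace Cap
variable {u v w y : V} {Y S : Finset V} {F : Finset (Finset V)} {A B : Finset V}

theorem four_le (hc : Cap G u v w Y) (hG : Ambient G) : 4 ≤ Y.card := by
  have := hG.deg w (insert u (insert v Y)) fun y hy => by
    have := (hc.nbr y).1 hy
    grind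
  have := Finset.card_insert_le u (insert v Y)
  have := Finset.card_insert_le v Y
  omega

theorem subset (hc : Cap G u v w Y) (h : Config G w y S F A B) (hy : y ∈ Y) :
    Y.erase y ⊆ S := by
  intro z hz
  rw [Finset.mem_erase] at hz
  exact h.mem_of_adj_of_adj ((hc.nbr z).2 (by simp [hz])) (hc.clique y hy z hz.2 hz.1.symm)

theorem three_le_erase (hc : Cap G u v w Y) (hG : Ambient G) (hy : y ∈ Y) :
    3 ≤ (Y.erase y).card := by
  have := hc.four_le hG
  rw [Finset.card_erase_of_mem hy]
  omega

theorem card_ne_five (hc : Cap G u v w Y) (hG : Ambient G) (h : Config G w y S F A B)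
    (hy : y ∈ Y) : S.card ≠ 5 := by
  intro h5
  have hsub := hc.subset h hy
  have h3 := hc.three_le_erase hG hy
  obtain ⟨m, hm, hM⟩ := h.exists_missed h5
  obtain ⟨hwm, hym, -⟩ := h.special hG.claw hm hM
  have hmY : m ∈ Y := by
    have h1 := (hc.nbr m).1 hwm
    have h2 := fun e => hc.nu y hy e
    have h3 := fun e => hc.nv y hy e
    have h4 := hym.symm
    grind
  obtain ⟨z, hz, hzm⟩ := Finset.exists_mem_ne (by omega : 1 < (Y.erase y).card) m
  have hmz := hc.clique m hmY z (Finset.mem_of_mem_erase hz) hzm.symm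
  have hA : A = {w} := by
    by_contra hA
    exact h.not_adj_missed hG h5 hm hM (h.one_lt_card_of_ne_singleton hA) (hsub hz) hmz
  have hB : B = {y} := by
    by_contra hB
    exact h.symm.not_adj_missed hG h5 hm hM (h.symm.one_lt_card_of_ne_singleton hB) (hsub hz) hmz
  have hu := h.mem_of_adj_of_eq_singleton hA ((hc.nbr u).2 (by simp))
  have hyu := hc.hu
  have huS : u ∈ S := by grind
  exact hc.nu y hy (h.symm.adj_of_eq_singleton hG h5 hB huS).symm

set_option maxHeartbeats 1000000 in
theorem exists_piece (hc : Cap G u v w Y) (hG : Ambient G) (h : Config G w y S F A B)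
    (hy : y ∈ Y) (h4 : S.card = 4) : ∃ s R, Piece G u w Y y s R := by
  have hsub := hc.subset h hy
  have h3 := hc.three_le_erase hG hy
  have hA := h.one_lt_card_of_card_eq_four hG h4
  have hB := h.symm.one_lt_card_of_card_eq_four hG h4
  have hwY : w ∉ Y := fun e => ((hc.nbr w).2 (by simp [e])).ne rfl
  have hwS := h.u_notMem
  have hyS := h.symm.u_notMem
  have hwy : w ≠ y := h.adj.ne
  have hwu : G.Adj w u := (hc.nbr u).2 (by simp)
  have hwv : G.Adj w v := (hc.nbr v).2 (by simp)
  have hpart := fun x (hx : x ∈ S) => h.exists_adj_of_card_eq_four h4 hx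
  have hcard := Finset.card_sdiff_add_card_eq_card hsub
  have hrest : ∀ x ∈ S, x ∉ Y → ∃ p ∈ Y, p ≠ y ∧ G.Adj x p := by
    intro x hx hxY
    obtain ⟨p, hp, hxp⟩ := hpart x hx
    have hle : (S \ Y.erase y).card ≤ 1 := by omega
    by_contra! hno
    have hpY : p ∉ Y.erase y := fun e => by
      rw [Finset.mem_erase] at e
      exact hno p e.2 e.1 hxp
    exact hxp.ne (Finset.card_le_one.1 hle x (by grind) p (by grind))
  have huS : u ∉ S := fun e => by
    obtain ⟨p, hp, -, hup⟩ := hrest u e hc.hu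
    exact hc.nu p hp hup
  have hvS : v ∉ S := fun e => by
    obtain ⟨p, hp, -, hup⟩ := hrest v e hc.hv
    exact hc.nv p hp hup
  have hcu := hc.hu
  have hcv := hc.hv
  have huA : u ∈ A := by
    have := h.closed h.memA h.hu hwu
    grind
  have hvA : v ∈ A := by
    have := h.closed h.memA h.hu hwv
    grind
  have hAS := h.fam.notMem A h.memA
  have hBS := h.fam.notMem B h.memB
  have hAB : ∀ x ∈ A, x ∉ B := fun x => h.notMem_of_mem h.memA h.memB h.ne
  have hwA := h.hu
  have hyB := h.hv
  have hAY : ∀ x ∈ A, x ∉ Y := by grind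
  have hBY : ∀ x ∈ B, x ≠ y → x ∉ Y := by grind
  set R := A.erase w with hR
  set R' := B.erase y with hR'
  have huR : u ∈ R := Finset.mem_erase.2 ⟨hwu.ne', huA⟩
  have hRcl : ∀ x ∈ R, ∀ z, G.Adj x z → z ∈ R ∨ z = w ∨ z ∈ S := by
    intro x hx z hxz
    rw [Finset.mem_erase] at hx
    have := h.closed h.memA hx.2 hxz
    grind
  have hR'cl : ∀ x ∈ R', ∀ z, G.Adj x z → z ∈ R' ∨ z = y ∨ z ∈ S := by
    intro x hx z hxz
    rw [Finset.mem_erase] at hx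
    have := h.closed h.memB hx.2 hxz
    grind
  have hRy : ∀ x ∈ R, ¬ G.Adj x y := by
    intro x hx hxy
    rw [Finset.mem_erase] at hx
    have := h.not_adj h.memA h.memB h.ne hx.2 hyB hxy
    grind
  have hwR' : ∀ x ∈ R', ¬ G.Adj w x := by
    intro x hx hwx
    rw [Finset.mem_erase] at hx
    have := h.not_adj h.memA h.memB h.ne hwA hx.2 hwx
    grind
  have hRcard : Even R.card := Finset.even_card_erase (h.fam.odd A h.memA) hwA
  have hR'card : Even R'.card := Finset.even_card_erase (h.fam.odd B h.memB) hyB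
  have hR'ne : R'.Nonempty := by
    rw [← Finset.card_pos, hR', Finset.card_erase_of_mem hyB]
    omega
  have hyA : y ∉ A := fun e => hAB y e hyB
  have hwB : w ∉ B := hAB w hwA
  have hR2 : 3 ≤ (insert w (nbrsIn G S R)).card := by
    refine hG.three_le_card_of_separates ⟨u, huR⟩ (fun x hx z hxz => ?_)
      ⟨y, fun e => hyA (Finset.mem_of_mem_erase e), fun e => ?_⟩
    · have h1 := hRcl x hx z hxz
      have h2 : z ∈ S → z ∈ nbrsIn G S R := fun e => mem_nbrsIn.2 ⟨e, x, hx, hxz⟩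
      grind
    · rw [Finset.mem_insert, mem_nbrsIn] at e
      grind
  have hR'2 : 3 ≤ (insert y (nbrsIn G S R')).card := by
    refine hG.three_le_card_of_separates hR'ne (fun x hx z hxz => ?_)
      ⟨w, fun e => hwB (Finset.mem_of_mem_erase e), fun e => ?_⟩
    · have h1 := hR'cl x hx z hxz
      have h2 : z ∈ S → z ∈ nbrsIn G S R' := fun e => mem_nbrsIn.2 ⟨e, x, hx, hxz⟩
      grind
    · rw [Finset.mem_insert, mem_nbrsIn] at e
      grind
  have hi := Finset.card_insert_le w (nbrsIn G S R)
  have hi' := Finset.card_insert_le y (nbrsIn G S R')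
  have hNR : nbrsIn G Y R ⊆ Y.erase y := by
    intro z hz
    obtain ⟨hzY, x, hx, hxz⟩ := mem_nbrsIn.1 hz
    refine Finset.mem_erase.2 ⟨?_, hzY⟩
    rintro rfl
    exact hRy x hx hxz
  have hNR' : nbrsIn G (Y.erase y) R' ⊆ Y.erase y := fun z hz => (mem_nbrsIn.1 hz).1
  have hdisj : Disjoint (nbrsIn G Y R) (nbrsIn G (Y.erase y) R') := by
    rw [Finset.disjoint_left]
    intro z hz hz'
    obtain ⟨hzY, x, hx, hxz⟩ := mem_nbrsIn.1 hz
    obtain ⟨-, x', hx', hxz'⟩ := mem_nbrsIn.1 hz'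
    rw [Finset.mem_erase] at hx hx'
    have hxu : x ≠ u := fun e => hc.nu z hzY (e ▸ hxz)
    have hxv : x ≠ v := fun e => hc.nv z hzY (e ▸ hxz)
    have h1 := hc.nbr x
    have h2 := h.not_adj h.memA h.memB h.ne hx.2 hx'.2
    have h3 := hAY x hx.2
    refine hG.claw z w x x' ((hc.nbr z).2 (by simp [hzY])).symm hxz.symm hxz'.symm hx.1.symm
      (by grind) (by grind) (by grind) (hwR' x' (Finset.mem_erase.2 hx')) (by grind)
  have hsum : (nbrsIn G Y R).card + (nbrsIn G (Y.erase y) R').card ≤ (Y.erase y).card := by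
    rw [← Finset.card_union_of_disjoint hdisj]
    exact Finset.card_le_card (Finset.union_subset hNR hNR')
  have hle := Finset.card_le_card hsub
  rcases Nat.lt_or_ge 3 (Y.erase y).card with h5 | h5
  · have hYS : Y.erase y = S := Finset.eq_of_subset_of_card_le hsub (by omega)
    have e1 : nbrsIn G S R ⊆ nbrsIn G Y R := by
      intro z hz
      rw [mem_nbrsIn, ← hYS] at hz
      exact mem_nbrsIn.2 ⟨Finset.mem_of_mem_erase hz.1, hz.2⟩
    have e2 := Finset.card_le_card e1
    rw [hYS] at hsum
    obtain ⟨p, q, hpq, hN⟩ := Finset.card_eq_two.1 (by omega : (nbrsIn G Y R).card = 2)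
    have hp : p ∈ nbrsIn G Y R := by simp [hN]
    have hq : q ∈ nbrsIn G Y R := by simp [hN]
    have hpY := (mem_nbrsIn.1 hp).1
    have hqY := (mem_nbrsIn.1 hq).1
    have hRS : ∀ x ∈ R, ∀ z ∈ S, G.Adj x z → z = p ∨ z = q := by
      intro x hx z hz hxz
      have h6 := e1 (mem_nbrsIn.2 ⟨hz, x, hx, hxz⟩)
      rw [hN] at h6
      simpa using h6
    refine (hG.not_odd_separated (Finset.odd_card_erase hRcard huR) hwu
      (hc.clique p hpY q hqY hpq) (by grind) (by grind) (by grind) (by grind) (by grind)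
      (by grind) (by grind) (by grind) fun x hx z hxz => ?_).elim
    rw [Finset.mem_erase] at hx
    have h7 := hRcl x hx.2 z hxz
    have h8 := hRS x hx.2 z
    rw [Finset.mem_erase]
    grind
  obtain ⟨s, hs⟩ := Finset.card_eq_one.1 (by omega : (S \ Y.erase y).card = 1)
  have hs' : s ∈ S \ Y.erase y := by simp [hs]
  have hSs : ∀ z ∈ S, z = s ∨ (z ∈ Y ∧ z ≠ y) := by
    intro z hz
    by_cases hzY : z ∈ Y.erase y
    · rw [Finset.mem_erase] at hzY
      exact Or.inr hzY.symm
    · have : z ∈ S \ Y.erase y := Finset.mem_sdiff.2 ⟨hz, hzY⟩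
      rw [hs] at this
      exact Or.inl (by simpa using this)
  rw [Finset.mem_sdiff] at hs'
  have hsY : s ∉ Y := by grind
  have hsub1 : nbrsIn G S R ⊆ insert s (nbrsIn G Y R) := by
    intro z hz
    rw [mem_nbrsIn] at hz
    have := hSs z hz.1
    rw [Finset.mem_insert, mem_nbrsIn]
    tauto
  have hsub2 : nbrsIn G S R' ⊆ insert s (nbrsIn G (Y.erase y) R') := by
    intro z hz
    rw [mem_nbrsIn] at hz
    have := hSs z hz.1
    rw [Finset.mem_insert, mem_nbrsIn, Finset.mem_erase]
    tauto
  have hc1 := (Finset.card_le_card hsub1).trans (Finset.card_insert_le _ _)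
  have hc2 := (Finset.card_le_card hsub2).trans (Finset.card_insert_le _ _)
  refine ⟨s, R, huR, fun x hx => ?_, fun x hx z hxz => ?_, hRy, fun X hX huX hXc => ?_,
    hrest s hs'.1 hsY, by omega, by omega, fun h2 y' hy' hne hny hsy' => ?_⟩
  · rw [Finset.mem_erase] at hx
    exact ⟨hAY x hx.2, hx.1, fun e => hAS x hx.2 (e ▸ hs'.1)⟩
  · have h6 := hRcl x hx z hxz
    have h7 := hSs z
    tauto
  · have h6 := h.conn A h.memA (insert w X)
      (Finset.insert_subset hwA (hX.trans (Finset.erase_subset _ _))) ⟨w, by simp⟩ ?_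
    · rw [hR, ← h6, Finset.erase_insert]
      exact fun e => (Finset.mem_erase.1 (hX e)).1 rfl
    · intro x hx z hz hxz
      by_cases hzw : z = w
      · simp [hzw]
      have hzR : z ∈ R := Finset.mem_erase.2 ⟨hzw, hz⟩
      refine Finset.mem_insert_of_mem ?_
      rcases Finset.mem_insert.1 hx with rfl | hx
      · rcases (hc.nbr z).1 hxz with rfl | rfl | h7
        · exact huX
        · exact hXc u huX z hzR hc.huv
        · exact (hAY z hz h7).elim
      · exact hXc x hx z hzR hxz
  · have hR'1 : nbrsIn G (Y.erase y) R' ⊆ {y'} := by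
      have h7 : ((Y.erase y) \ nbrsIn G Y R).card = 1 := by
        rw [Finset.card_sdiff_of_subset hNR]
        omega
      obtain ⟨q, hq⟩ := Finset.card_eq_one.1 h7
      have h8 : y' ∈ (Y.erase y) \ nbrsIn G Y R :=
        Finset.mem_sdiff.2 ⟨Finset.mem_erase.2 ⟨hne, hy'⟩, hny⟩
      rw [hq, Finset.mem_singleton] at h8
      rw [h8, ← hq]
      intro z hz
      exact Finset.mem_sdiff.2 ⟨hNR' hz, fun e => Finset.disjoint_left.1 hdisj e hz⟩
    have hR'S : ∀ x ∈ R', ∀ z ∈ S, G.Adj x z → z = s ∨ z = y' := by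
      intro x hx z hz hxz
      rcases hSs z hz with h6 | h6
      · exact Or.inl h6
      · have := hR'1 (mem_nbrsIn.2 ⟨Finset.mem_erase.2 h6.symm, x, hx, hxz⟩)
        exact Or.inr (by simpa using this)
    have hy'S : y' ∈ S := hsub (Finset.mem_erase.2 ⟨hne, hy'⟩)
    obtain ⟨r, hr, hry⟩ : ∃ r ∈ R', G.Adj r y := by
      by_contra! hno
      have h7 : nbrsIn G S R' ⊆ {s, y'} := by
        intro z hz
        obtain ⟨hz, x, hx, hxz⟩ := mem_nbrsIn.1 hz
        have := hR'S x hx z hz hxz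
        grind
      have h8 := hG.three_le_card_of_separates (C := {s, y'}) hR'ne (fun x hx z hxz => by
        have := hR'cl x hx z hxz
        have := hR'S x hx z
        have := hno x hx
        grind) ⟨w, fun e => hwB (Finset.mem_of_mem_erase e), by grind⟩
      have : ({s, y'} : Finset V).card ≤ 2 := Finset.card_le_two
      omega
    have hr' := Finset.mem_erase.1 hr
    have hrS := hBS r hr'.2
    refine hG.not_odd_separated (Finset.odd_card_erase hR'card hr) hry hsy'
      (fun e => hrS (e ▸ hs'.1)) (fun e => hrS (e ▸ hy'S)) (fun e => hyS (e ▸ hs'.1)) hne.symm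
      (by simp) (fun e => (Finset.mem_erase.1 (Finset.mem_of_mem_erase e)).1 rfl)
      (fun e => hBS s (Finset.mem_of_mem_erase (Finset.mem_of_mem_erase e)) hs'.1)
      (fun e => hBS y' (Finset.mem_of_mem_erase (Finset.mem_of_mem_erase e)) hy'S) fun x hx z hxz => ?_
    rw [Finset.mem_erase] at hx
    have h9 := hR'cl x hx.2 z hxz
    have h10 := hR'S x hx.2 z
    rw [Finset.mem_erase]
    grind

theorem false (hc : Cap G u v w Y) (hG : Ambient G)
    (hE : ∀ u v, G.Adj u v → ∃ S F A B, Config G u v S F A B) : False := by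
  have hY : Y.Nonempty := Finset.card_pos.1 (by have := hc.four_le hG; omega)
  have hp : ∀ y ∈ Y, ∃ s R, Piece G u w Y y s R := by
    intro y hy
    obtain ⟨S, F, A, B, h⟩ := hE w y ((hc.nbr y).2 (by simp [hy]))
    exact hc.exists_piece hG h hy
      ((h.card_eq_four_or_five hG).resolve_right (hc.card_ne_five hG h hy))
  have : Nonempty V := ⟨u⟩
  choose! s R hp using hp
  exact Piece.not_all hY hp

end Cap

namespace Config
variable {u v : V} {S : Finset V} {F : Finset (Finset V)} {A B : Finset V}

theorem eq_singleton_of_card_eq_five (h : Config G u v S F A B) (hG : Ambient G)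
    (hE : ∀ u v, G.Adj u v → ∃ S F A B, Config G u v S F A B) (h5 : S.card = 5) : A = {u} := by
  classical
  by_contra hA
  obtain ⟨w, hw, hM⟩ := h.exists_missed h5
  have hiso := fun x (hx : x ∈ S) => h.not_adj_missed hG h5 hw hM
    (h.one_lt_card_of_ne_singleton hA) hx
  obtain ⟨huw, hvw, O, hO, hOA, hOB, -, hcl, hcliq⟩ := h.special hG.claw hw hM
  have huO : u ∉ O := fun e => hOA (h.eqA hO e)
  have hvO : v ∉ O := fun e => hOB (h.eqB hO e)
  refine Cap.false (u := u) (v := v) (w := w) (Y := O.filter (G.Adj w)) ⟨h.adj, fun y => ?_,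
    fun y hy y' hy' hne => ?_, fun y hy hadj => ?_, fun y hy hadj => ?_, ?_, ?_⟩ hG hE
  · have h1 := hcl y
    have h2 := hiso y
    have h3 := huw.symm
    have h4 := hvw.symm
    rw [Finset.mem_filter]
    grind
  · rw [Finset.mem_filter] at hy hy'
    exact hcliq y hy.1 y' hy'.1 hy.2 hy'.2 hne
  · rw [Finset.mem_filter] at hy
    have := h.not_adj h.memA hO hOA.symm h.hu hy.1 hadj
    grind
  · rw [Finset.mem_filter] at hy
    have := h.not_adj h.memB hO hOB.symm h.hv hy.1 hadj
    grind
  · exact fun e => huO (Finset.mem_filter.1 e).1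
  · exact fun e => hvO (Finset.mem_filter.1 e).1

end Config

end

theorem SimpleGraph.Reachable.induction {W : Type*} {K : SimpleGraph W} {p : W → Prop}
    (hp : ∀ x y, p x → K.Adj x y → p y) {x y : W} (h : K.Reachable x y) (hx : p x) : p y := by
  obtain ⟨q⟩ := h
  induction q with
  | nil => exact hx
  | cons hadj _ ih => exact ih (hp _ _ hx hadj)

section Components
variable {V W : Type*} [Fintype V] [DecidableEq V] {H : SimpleGraph V} {K : SimpleGraph W}
  {ι : W → V} {S : Finset V}

/-- The vertex set in `V` of a component of a graph embedded along `ι`. -/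
noncomputable def compSet (ι : W → V) (C : K.ConnectedComponent) : Finset V :=
  (Set.toFinite (ι '' C.supp)).toFinset

/-- The family of vertex sets of odd components. -/
noncomputable def compFamily (K : SimpleGraph W) (ι : W → V) : Finset (Finset V) :=
  (Set.toFinite (compSet ι '' {C : K.ConnectedComponent | Odd C.supp.ncard})).toFinset

theorem mem_compSet {C : K.ConnectedComponent} {x : V} :
    x ∈ compSet ι C ↔ ∃ w, K.connectedComponentMk w = C ∧ ι w = x := by
  simp [compSet]

theorem mem_compFamily {O : Finset V} :
    O ∈ compFamily K ι ↔ ∃ C : K.ConnectedComponent, Odd C.supp.ncard ∧ compSet ι C = O := by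
  simp [compFamily]

theorem mem_compSet_mk (hι : ι.Injective) {w x : W} :
    ι w ∈ compSet ι (K.connectedComponentMk x) ↔
      K.connectedComponentMk w = K.connectedComponentMk x := by
  rw [mem_compSet]
  constructor
  · rintro ⟨w', h, e⟩
    rwa [← hι e]
  · exact fun h => ⟨w, h, rfl⟩

theorem card_compSet (hι : ι.Injective) (C : K.ConnectedComponent) :
    (compSet ι C).card = C.supp.ncard := by
  rw [compSet, ← Set.ncard_eq_toFinset_card, Set.ncard_image_of_injective _ hι]

theorem compSet_injective (hι : ι.Injective) :
    (compSet ι : K.ConnectedComponent → Finset V).Injective := by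
  intro C C' h
  induction C using ConnectedComponent.ind with | _ x
  have h1 := (mem_compSet_mk (K := K) hι (w := x) (x := x)).2 rfl
  rw [h, mem_compSet] at h1
  obtain ⟨w, hw, e⟩ := h1
  rw [← hw, hι e]

theorem card_compFamily (hι : ι.Injective) :
    (compFamily K ι).card = {C : K.ConnectedComponent | Odd C.supp.ncard}.ncard := by
  rw [compFamily, ← Set.ncard_eq_toFinset_card, Set.ncard_image_of_injective _
    (compSet_injective hι)]

theorem oddFamily_compFamily (hι : ι.Injective) (hS : ∀ w, ι w ∉ S) (hS' : ∀ x ∉ S, ∃ w, ι w = x)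
    (hK : ∀ w w', H.Adj (ι w) (ι w') → K.Adj w w') : OddFamily H S (compFamily K ι) where
  odd O hO := by
    obtain ⟨C, hC, rfl⟩ := mem_compFamily.1 hO
    rwa [card_compSet hι]
  disj O hO O' hO' x hx hx' := by
    obtain ⟨C, hC, rfl⟩ := mem_compFamily.1 hO
    obtain ⟨C', hC', rfl⟩ := mem_compFamily.1 hO'
    obtain ⟨w, rfl, rfl⟩ := mem_compSet.1 hx
    obtain ⟨w', rfl, e⟩ := mem_compSet.1 hx'
    rw [hι e]
  notMem O hO x hx := by
    obtain ⟨C, hC, rfl⟩ := mem_compFamily.1 hO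
    obtain ⟨w, rfl, rfl⟩ := mem_compSet.1 hx
    exact hS w
  closed O hO x hx y hxy := by
    obtain ⟨C, hC, rfl⟩ := mem_compFamily.1 hO
    obtain ⟨w, rfl, rfl⟩ := mem_compSet.1 hx
    by_cases hy : y ∈ S
    · exact Or.inr hy
    obtain ⟨w', rfl⟩ := hS' y hy
    rw [mem_compSet_mk hι]
    exact Or.inl (ConnectedComponent.sound (hK w w' hxy).symm.reachable)

theorem eq_compSet_of_closed (hι : ι.Injective) (hK : ∀ w w', K.Adj w w' → H.Adj (ι w) (ι w'))
    {C : K.ConnectedComponent} {X : Finset V} (hX : X ⊆ compSet ι C) (hne : X.Nonempty)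
    (hcl : ∀ x ∈ X, ∀ y ∈ compSet ι C, H.Adj x y → y ∈ X) : X = compSet ι C := by
  refine hX.antisymm fun y hy => ?_
  obtain ⟨x, hx⟩ := hne
  obtain ⟨w, rfl, rfl⟩ := mem_compSet.1 (hX hx)
  obtain ⟨w', h', rfl⟩ := mem_compSet.1 hy
  refine (ConnectedComponent.exact h').symm.induction (p := fun w' => ι w' ∈ X) ?_ hx
  intro a b ha hab
  refine hcl _ ha _ ?_ (hK _ _ hab)
  obtain ⟨a', e1, e2⟩ := mem_compSet.1 (hX ha)
  rw [hι e2] at e1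
  exact mem_compSet.2 ⟨b, (ConnectedComponent.sound hab.symm.reachable).trans e1, rfl⟩

theorem card_le_card_compFamily [Finite W] (hι : ι.Injective) (hS' : ∀ x ∉ S, ∃ w, ι w = x)
    (hS : ∀ w, ι w ∉ S)
    (hK : ∀ w w', K.Adj w w' → H.Adj (ι w) (ι w')) {F : Finset (Finset V)}
    (hF : OddFamily H S F) : F.card ≤ (compFamily K ι).card := by
  classical
  have := Fintype.ofFinite W
  have key : ∀ O ∈ F, ∃ C ∈ compFamily K ι, C ⊆ O := by
    intro O hO
    set O' : Finset W := Finset.univ.filter (ι · ∈ O) with hO'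
    have hcard : O'.card = O.card := by
      rw [← Finset.card_image_of_injective O' hι]
      congr 1
      ext x
      simp only [hO', Finset.mem_image, Finset.mem_filter, Finset.mem_univ, true_and]
      refine ⟨?_, fun hx => ?_⟩
      · rintro ⟨w, hw, rfl⟩
        exact hw
      · obtain ⟨w, rfl⟩ := hS' x (hF.notMem O hO x hx)
        exact ⟨w, hx, rfl⟩
    have hsum := Finset.card_eq_sum_card_fiberwise (s := O') (t := Finset.univ)
      (f := K.connectedComponentMk) (by simp)
    obtain ⟨C, hC⟩ : ∃ C, Odd (O'.filter (K.connectedComponentMk · = C)).card := by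
      by_contra! hno
      have h1 : Even O'.card := by
        rw [hsum]
        exact Finset.even_sum _ fun C _ => Nat.not_odd_iff_even.1 (hno C)
      rw [hcard] at h1
      exact Nat.not_even_iff_odd.2 (hF.odd O hO) h1
    obtain ⟨w, hw⟩ := Finset.card_pos.1 hC.pos
    simp only [hO', Finset.mem_filter, Finset.mem_univ, true_and] at hw
    obtain ⟨hw, rfl⟩ := hw
    have hin : ∀ w', K.connectedComponentMk w' = K.connectedComponentMk w → ι w' ∈ O := by
      intro w' hw'
      refine (ConnectedComponent.exact hw').symm.induction (p := fun w' => ι w' ∈ O) ?_ hw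
      intro a b ha hab
      exact (hF.closed O hO _ ha _ (hK _ _ hab)).resolve_right (hS b)
    refine ⟨compSet ι (K.connectedComponentMk w), mem_compFamily.2 ⟨_, ?_, rfl⟩, fun x hx => ?_⟩
    · rw [← Set.ncard_coe_finset] at hC
      convert hC using 2
      ext w'
      simp only [hO', ConnectedComponent.mem_supp_iff, Finset.coe_filter, Finset.mem_filter,
        Finset.mem_univ, true_and, Set.mem_ofPred_eq]
      exact ⟨fun e => ⟨hin w' e, e⟩, fun e => e.2⟩
    · obtain ⟨w', e, rfl⟩ := mem_compSet.1 hx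
      exact hin w' e
  choose! g hg hg' using key
  refine Finset.card_le_card_of_injOn g hg fun O hO O' hO' e => ?_
  obtain ⟨C, hC, h1⟩ := mem_compFamily.1 (hg O hO)
  obtain ⟨w, rfl⟩ := C.exists_rep
  have h2 : ι w ∈ g O := by rw [← h1]; exact (mem_compSet_mk hι).2 rfl
  exact hF.disj O hO O' hO' _ (hg' O hO h2) (hg' O' hO' (e ▸ h2))

end Components

section

variable {V : Type*} [Fintype V] [DecidableEq V] {G : SimpleGraph V}

theorem SimpleGraph.Subgraph.IsMatching.disjoint_of_ne {M : G.Subgraph} (hM : M.IsMatching)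
    {a b c d : V} (hab : M.Adj a b) (hcd : M.Adj c d) (h : s(a, b) ≠ s(c, d)) :
    a ≠ c ∧ a ≠ d ∧ b ≠ c ∧ b ≠ d := by
  refine ⟨?_, ?_, ?_, ?_⟩ <;> rintro rfl
  · exact h (by rw [hM.eq_of_adj_left hab hcd])
  · exact h (by rw [hM.eq_of_adj_left hab hcd.symm, Sym2.eq_swap])
  · exact h (by rw [hM.eq_of_adj_left hab.symm hcd, Sym2.eq_swap])
  · exact h (by rw [hM.eq_of_adj_left hab.symm hcd.symm])

theorem SimpleGraph.Subgraph.IsMatching.exists_two {M : G.Subgraph} (hM : M.IsMatching)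
    (h : 2 ≤ M.edgeSet.ncard) : ∃ a b c d, M.Adj a b ∧ M.Adj c d ∧
      a ≠ c ∧ a ≠ d ∧ b ≠ c ∧ b ≠ d := by
  obtain ⟨e, e', he, he', hne⟩ := (Set.one_lt_ncard_iff (Set.toFinite _)).1 h
  induction e with | _ a b
  induction e' with | _ c d
  exact ⟨a, b, c, d, he, he', hM.disjoint_of_ne he he' hne⟩

theorem SimpleGraph.Subgraph.IsMatching.exists_three {M : G.Subgraph} (hM : M.IsMatching)
    (h : 3 ≤ M.edgeSet.ncard) : ∃ a b c d e f, M.Adj a b ∧ M.Adj c d ∧ M.Adj e f ∧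
      [a, b, c, d, e, f].Nodup := by
  obtain ⟨x, y, z, hx, hy, hz, h1, h2, h3⟩ := (Set.two_lt_ncard_iff (Set.toFinite _)).1 h
  induction x with | _ a b
  induction y with | _ c d
  induction z with | _ e f
  have k1 := hM.disjoint_of_ne hx hy h1
  have k2 := hM.disjoint_of_ne hx hz h2
  have k3 := hM.disjoint_of_ne hy hz h3
  refine ⟨a, b, c, d, e, f, hx, hy, hz, ?_⟩
  have := hx.adj_sub.ne
  have := hy.adj_sub.ne
  have := hz.adj_sub.ne
  simp
  grind

theorem SimpleGraph.Subgraph.IsMatching.twoMatching {M : G.Subgraph} (hM : M.IsMatching)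
    (h : 2 ≤ M.edgeSet.ncard) {S : Finset V} (hS : M.verts ⊆ S) : TwoMatching G S := by
  obtain ⟨a, b, c, d, hab, hcd, hne⟩ := hM.exists_two h
  exact ⟨a, b, c, d, hS (M.edge_vert hab), hS (M.edge_vert hab.symm), hS (M.edge_vert hcd),
    hS (M.edge_vert hcd.symm), hab.adj_sub, hcd.adj_sub, hne⟩

theorem SimpleGraph.exists_isMatching_of_two {a b c d : V} (hab : G.Adj a b) (hcd : G.Adj c d)
    (h1 : a ≠ c) (h2 : a ≠ d) (h3 : b ≠ c) (h4 : b ≠ d) :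
    ∃ M : G.Subgraph, M.IsMatching ∧ M.edgeSet.ncard = 2 ∧ M.verts = {a, b, c, d} ∧
      M.Adj a b ∧ M.Adj c d := by
  refine ⟨G.subgraphOfAdj hab ⊔ G.subgraphOfAdj hcd, ?_, ?_, ?_, ?_, ?_⟩
  · refine (Subgraph.IsMatching.subgraphOfAdj hab).sup (Subgraph.IsMatching.subgraphOfAdj hcd) ?_
    rw [support_subgraphOfAdj, support_subgraphOfAdj, Set.disjoint_left]
    intro x
    simp only [Set.mem_insert_iff, Set.mem_singleton_iff]
    grind
  · rw [Subgraph.edgeSet_sup, edgeSet_subgraphOfAdj, edgeSet_subgraphOfAdj, Set.singleton_union,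
      Set.ncard_pair]
    rw [Ne, Sym2.eq_iff]
    grind
  · ext x
    simp
    grind
  · simp
  · simp

theorem SimpleGraph.Subgraph.IsPerfectMatching.exists_involution {P : G.Subgraph}
    (hP : P.IsPerfectMatching) :
    ∃ f : V → V, (∀ x, P.Adj x (f x)) ∧ ∀ x, f (f x) = x := by
  choose f hf hf' using Subgraph.isPerfectMatching_iff.1 hP
  exact ⟨f, hf, fun x => (hf' _ _ (hf x).symm).symm⟩

theorem SimpleGraph.exists_isPerfectMatching_of_involution {f : V → V}
    (hf : ∀ x, G.Adj x (f x)) (hff : ∀ x, f (f x) = x) :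
    ∃ P : G.Subgraph, P.IsPerfectMatching ∧ ∀ x, P.Adj x (f x) := by
  refine ⟨⟨Set.univ, fun x y => f x = y, ?_, ?_, ⟨?_⟩⟩, ?_, ?_⟩
  · rintro x _ rfl
    exact hf x
  · simp
  · rintro x _ rfl
    exact hff x
  · rw [Subgraph.isPerfectMatching_iff]
    exact fun x => ⟨f x, rfl, fun y (hy : f x = y) => hy.symm⟩
  · exact fun x => rfl

theorem KExt.ambient [DecidableRel G.Adj] (hclaw : ClawFree G) (hG : KExt G 2)
    (hdeg : 6 ≤ G.minDegree) : Ambient G where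
  claw := hclaw
  conn := hG.1
  even := by
    obtain ⟨P, hP⟩ := hG.2.1
    obtain ⟨f, hf, hff⟩ := hP.exists_involution
    rw [← Finset.card_univ]
    exact Finset.even_card_of_involution f (fun x => (hf x).adj_sub.ne') hff (by simp)
  deg x T hT := by
    refine (hdeg.trans (G.minDegree_le_degree x)).trans (Finset.card_le_card fun y hy => hT y ?_)
    simpa using hy
  ext a b c d hab hcd h1 h2 h3 h4 := by
    obtain ⟨M, hM, hcard, -, m1, m2⟩ := exists_isMatching_of_two hab hcd h1 h2 h3 h4
    obtain ⟨P, hP, hle⟩ := hG.2.2 M hM hcard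
    obtain ⟨f, hf, hff⟩ := hP.exists_involution
    exact ⟨f, fun x => (hf x).adj_sub, hff, hP.1.eq_of_adj_left (hf a) (hle.2 m1),
      hP.1.eq_of_adj_left (hf c) (hle.2 m2)⟩

theorem OddFamily.exists_card_add_two {H : SimpleGraph V} {S : Finset V} {F : Finset (Finset V)}
    (heven : Even (Fintype.card V)) (hF : OddFamily H S F) (hle : S.card ≤ F.card + 3) :
    ∃ F', OddFamily H S F' ∧ S.card ≤ F'.card + 2 := by
  rcases Nat.lt_or_ge (F.card + 2) S.card with hlt | hge
  swap
  · exact ⟨F, hF, hge⟩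
  set K := (S ∪ F.biUnion id)ᶜ with hK
  have hmem : ∀ x, x ∈ K ↔ x ∉ S ∧ ∀ O ∈ F, x ∉ O := by
    intro x
    simp [hK]
  have hdisj : Disjoint S (F.biUnion id) := by
    rw [Finset.disjoint_left]
    intro x hx hx'
    obtain ⟨O, hO, hxO⟩ := Finset.mem_biUnion.1 hx'
    exact hF.notMem O hO x hxO hx
  have hsum : (F.biUnion id).card = ∑ O ∈ F, O.card := by
    refine Finset.card_biUnion fun O hO O' hO' hne => ?_
    rw [Function.onFun, Finset.disjoint_left]
    exact fun x hx hx' => hne (hF.disj O hO O' hO' x hx hx')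
  have hpar : Odd (∑ O ∈ F, O.card) ↔ Odd F.card := by
    rw [Finset.odd_sum_iff_odd_card_odd, Finset.filter_true_of_mem hF.odd]
  have hKodd : Odd K.card := by
    rw [hK, Finset.card_compl, Finset.card_union_of_disjoint hdisj, hsum]
    have h1 := Finset.card_le_univ (S ∪ F.biUnion id)
    rw [Finset.card_union_of_disjoint hdisj, hsum] at h1
    have h2 : S.card = F.card + 3 := by omega
    rw [h2] at h1 ⊢
    grind
  have hKF : K ∉ F := by
    intro h
    obtain ⟨x, hx⟩ := Finset.card_pos.1 hKodd.pos
    exact ((hmem x).1 hx).2 K h hx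
  refine ⟨insert K F, ⟨?_, ?_, ?_, ?_⟩, ?_⟩
  · intro O hO
    rcases Finset.mem_insert.1 hO with rfl | hO
    exacts [hKodd, hF.odd O hO]
  · intro O hO O' hO' x hx hx'
    rcases Finset.mem_insert.1 hO with rfl | hO <;> rcases Finset.mem_insert.1 hO' with rfl | hO'
    · rfl
    · exact absurd hx' (((hmem x).1 hx).2 O' hO')
    · exact absurd hx (((hmem x).1 hx').2 O hO)
    · exact hF.disj O hO O' hO' x hx hx'
  · intro O hO x hx
    rcases Finset.mem_insert.1 hO with rfl | hO
    exacts [((hmem x).1 hx).1, hF.notMem O hO x hx]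
  · intro O hO x hx y hxy
    rcases Finset.mem_insert.1 hO with rfl | hO
    · by_cases hy : y ∈ S
      · exact Or.inr hy
      refine Or.inl ((hmem y).2 ⟨hy, fun O hO hyO => ?_⟩)
      rcases hF.closed O hO y hyO x hxy.symm with h | h
      exacts [((hmem x).1 hx).2 O hO h, ((hmem x).1 hx).1 h]
    · exact hF.closed O hO x hx y hxy
  · rw [Finset.card_insert_of_notMem hKF]
    omega

theorem oddFamily_Ge (G : SimpleGraph V) (u v : V) (S : Finset V) :
    OddFamily (G.deleteEdges {s(u, v)}) S (compFamily (Ge G u v S) Subtype.val) :=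
  oddFamily_compFamily Subtype.val_injective (fun w h => w.2 (Finset.mem_coe.2 h))
    (fun x hx => ⟨⟨x, by simpa using hx⟩, rfl⟩) (fun _ _ h => h)

theorem card_le_card_compFamily_Ge {u v : V} {S : Finset V} {F : Finset (Finset V)}
    (hF : OddFamily (G.deleteEdges {s(u, v)}) S F) :
    F.card ≤ (compFamily (Ge G u v S) Subtype.val).card :=
  card_le_card_compFamily (K := Ge G u v S) Subtype.val_injective (fun x hx => ⟨⟨x, by simpa using hx⟩, rfl⟩)
    (fun w h => w.2 (Finset.mem_coe.2 h)) (fun _ _ h => h) hF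

theorem Ambient.admissible (hG : Ambient G) {u v : V} {S : Finset V} {F : Finset (Finset V)}
    (hS : TwoMatching G S) (hF : OddFamily (G.deleteEdges {s(u, v)}) S F)
    (hle : S.card ≤ F.card + 3) : Admissible G 2 u v S := by
  obtain ⟨F', hF', hle'⟩ := hF.exists_card_add_two hG.even hle
  have h1 := card_le_card_compFamily_Ge hF'
  obtain ⟨h2, h3⟩ := hG.card_add_two_le hS (oddFamily_Ge G u v S)
  obtain ⟨A, hA, B, hB, hne, huA, hvB⟩ := h3 (by omega)
  obtain ⟨C, hC, rfl⟩ := mem_compFamily.1 hA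
  obtain ⟨C', hC', rfl⟩ := mem_compFamily.1 hB
  obtain ⟨⟨u, hu⟩, rfl, e⟩ := mem_compSet.1 huA
  dsimp only at e
  subst e
  obtain ⟨⟨v, hv⟩, rfl, e⟩ := mem_compSet.1 hvB
  dsimp only at e
  subst e
  refine ⟨hu, hv, ?_, ?_, hu, hv, ?_, hC, hC'⟩
  · obtain ⟨a, b, c, d, ha, hb, hc, hd, hab, hcd, k1, k2, k3, k4⟩ := hS
    obtain ⟨M, hM, hcard, hverts, -⟩ := exists_isMatching_of_two hab hcd k1 k2 k3 k4
    refine ⟨M, hM, ?_, hcard.ge⟩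
    rw [hverts]
    intro x
    simp only [Set.mem_insert_iff, Set.mem_singleton_iff, Finset.mem_coe]
    rintro (rfl | rfl | rfl | rfl) <;> assumption
  · rw [card_compFamily Subtype.val_injective] at h1 h2
    rw [Set.ncard_coe_finset]
    change Set.ncard {C : (Ge G u v S).ConnectedComponent | Odd C.supp.ncard} + 4 = _
    omega
  · intro h
    exact hne (congrArg _ h)

/-- The configuration formed by a minimum admissible set. -/
theorem Admissible.config (hG : Ambient G) {u v : V} (huv : G.Adj u v) {S : Finset V}
    (hS : Admissible G 2 u v S)
    (hmin : ∀ S' : Finset V, Admissible G 2 u v S' → S.card ≤ S'.card)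
    (hu : u ∈ (S : Set V)ᶜ) (hv : v ∈ (S : Set V)ᶜ) :
    Config G u v S (compFamily (Ge G u v S) Subtype.val)
      (compSet Subtype.val ((Ge G u v S).connectedComponentMk ⟨u, hu⟩))
      (compSet Subtype.val ((Ge G u v S).connectedComponentMk ⟨v, hv⟩)) := by
  obtain ⟨-, -, ⟨M, hM, hMS, hcard⟩, hodd, _, _, hne, hC, hC'⟩ := hS
  exact
    { adj := huv
      two := hM.twoMatching hcard hMS
      card := by
        rw [card_compFamily Subtype.val_injective]
        rw [Set.ncard_coe_finset] at hodd
        omega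
      fam := oddFamily_Ge G u v S
      memA := mem_compFamily.2 ⟨_, hC, rfl⟩
      memB := mem_compFamily.2 ⟨_, hC', rfl⟩
      ne := fun h => hne (compSet_injective Subtype.val_injective h)
      hu := mem_compSet.2 ⟨_, rfl, rfl⟩
      hv := mem_compSet.2 ⟨_, rfl, rfl⟩
      conn := by
        intro O hO X hX hXne hcl
        obtain ⟨C, -, rfl⟩ := mem_compFamily.1 hO
        exact eq_compSet_of_closed Subtype.val_injective
          (fun _ _ h => (G.deleteEdges_le {s(u, v)}) h) hX hXne hcl
      min := fun S' F' h2 hF hle => hmin S' (hG.admissible h2 hF hle) }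

theorem Ambient.exists_config (hG : Ambient G) {u v : V} (huv : G.Adj u v)
    (hex : ∃ S F, TwoMatching G S ∧ OddFamily (G.deleteEdges {s(u, v)}) S F ∧
      S.card ≤ F.card + 3) : ∃ S F A B, Config G u v S F A B := by
  obtain ⟨S, hS, hmin⟩ : ∃ S : Finset V, Admissible G 2 u v S ∧
      ∀ S' : Finset V, Admissible G 2 u v S' → S.card ≤ S'.card := by
    obtain ⟨S, F, h2, hF, hle⟩ := hex
    obtain ⟨S', h, h'⟩ := exists_minimalFor_of_wellFoundedLT
      (fun S : Finset V => Admissible G 2 u v S) Finset.card ⟨S, hG.admissible h2 hF hle⟩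
    exact ⟨S', h, fun T hT => (le_total _ _).elim id (fun hle => h' hT hle)⟩
  exact ⟨S, _, _, _, hS.config hG huv hmin hS.1 hS.2.1⟩

theorem Ambient.deleteEdges_connected (hG : Ambient G) {u v : V} (huv : G.Adj u v) :
    (G.deleteEdges {s(u, v)}).Connected := by
  classical
  set H := G.deleteEdges {s(u, v)} with hH
  suffices hreach : ∀ y, H.Reachable u y by
    have : Nonempty V := ⟨u⟩
    exact ⟨fun x y => (hreach x).symm.trans (hreach y)⟩
  by_contra! hno
  obtain ⟨z, hz⟩ := hno
  set X := Finset.univ.filter (H.Reachable u ·) with hX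
  have hmem : ∀ x, x ∈ X ↔ H.Reachable u x := by simp [hX]
  have huX : u ∈ X := (hmem u).2 (Reachable.refl _)
  have hcl : ∀ x ∈ X, ∀ y, H.Adj x y → y ∈ X := fun x hx y hxy =>
    (hmem y).2 (((hmem x).1 hx).trans hxy.reachable)
  have hvX : v ∉ X := by
    intro hv
    obtain ⟨x, hx, y, hy, hxy⟩ := hG.exists_adj_of_mem ⟨u, huX⟩ ⟨z, fun h => hz ((hmem z).1 h)⟩
    refine hy (hcl x hx y (hxy.deleteEdges_of_ne ?_ ?_)) <;> rintro - rfl <;> exact hy ‹_›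
  obtain ⟨x, hx, hxv⟩ := hG.exists_adj_notMem u (T := {v}) (by simp)
  rw [Finset.mem_singleton] at hxv
  have hxX : x ∈ X := hcl u huX x (hx.deleteEdges_of_ne (by grind) (by grind [huv.ne]))
  have := hG.three_le_card_of_separates (X := X.erase u) (C := {u})
    ⟨x, Finset.mem_erase.2 ⟨hx.ne', hxX⟩⟩ ?_ ⟨v, ?_⟩
  · simp at this
  · intro a ha b hab
    rw [Finset.mem_erase] at ha
    have : b ∈ X := hcl a ha.2 b (hab.deleteEdges_of_ne (by grind) (by grind))
    grind
  · grind [huv.ne]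

theorem Ambient.deleteEdges_exists_isPerfectMatching (hG : Ambient G) {u v : V}
    (huv : G.Adj u v) : ∃ P : (G.deleteEdges {s(u, v)}).Subgraph, P.IsPerfectMatching := by
  obtain ⟨x, hx, hxv⟩ := hG.exists_adj_notMem u (T := {v}) (by simp)
  obtain ⟨y, hy, hyT⟩ := hG.exists_adj_notMem v (T := {u, x}) (by grind)
  rw [Finset.mem_singleton] at hxv
  simp only [Finset.mem_insert, Finset.mem_singleton, not_or] at hyT
  obtain ⟨f, hf, hff, fu, fv⟩ := hG.ext u x v y hx hy huv.ne (Ne.symm hyT.1) hxv (Ne.symm hyT.2)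
  obtain ⟨P, hP, -⟩ := exists_isPerfectMatching_of_involution
    (G := G.deleteEdges {s(u, v)}) (f := f)
    (fun z => (hf z).deleteEdges_of_ne (by grind) (by grind)) hff
  exact ⟨P, hP⟩

/-- A graph in which some 2-matching does not extend has a set violating Tutte's condition. -/
theorem SimpleGraph.exists_isPerfectMatching_or_oddFamily {H : SimpleGraph V} {a b c d : V}
    (hab : H.Adj a b) (hcd : H.Adj c d) (h1 : a ≠ c) (h2 : a ≠ d) (h3 : b ≠ c) (h4 : b ≠ d) :
    (∃ P : H.Subgraph, P.IsPerfectMatching ∧ P.Adj a b ∧ P.Adj c d) ∨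
      ∃ S F, a ∈ S ∧ b ∈ S ∧ c ∈ S ∧ d ∈ S ∧ OddFamily H S F ∧ S.card ≤ F.card + 3 := by
  classical
  set Q : Set V := {a, b, c, d}ᶜ with hQ
  have hmem : ∀ x, x ∈ Q ↔ x ≠ a ∧ x ≠ b ∧ x ≠ c ∧ x ≠ d := by
    intro x
    simp [hQ]
  by_cases hP : ∃ P : (H.induce Q).Subgraph, P.IsPerfectMatching
  · left
    obtain ⟨P, hP⟩ := hP
    obtain ⟨f, hf, hff⟩ := hP.exists_involution
    set g : V → V := fun x => if h : x ∈ Q then (f ⟨x, h⟩ : V) else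
      if x = a then b else if x = b then a else if x = c then d else c with hg
    have hgQ : ∀ x (h : x ∈ Q), g x = f ⟨x, h⟩ := fun x h => by simp [hg, h]
    have ga : g a = b := by simp [hg, hmem]
    have gb : g b = a := by simp [hg, hmem, hab.ne']
    have gc : g c = d := by simp [hg, hmem, h1.symm, h3.symm]
    have gd : g d = c := by simp [hg, hmem, h2.symm, h4.symm, hcd.ne']
    have hcases : ∀ x, x ∈ Q ∨ x = a ∨ x = b ∨ x = c ∨ x = d := by
      intro x
      rw [hmem]
      tauto
    have hgadj : ∀ x, H.Adj x (g x) := by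
      intro x
      rcases hcases x with h | rfl | rfl | rfl | rfl
      · rw [hgQ x h]
        exact (hf ⟨x, h⟩).adj_sub
      · rwa [ga]
      · rw [gb]
        exact hab.symm
      · rwa [gc]
      · rw [gd]
        exact hcd.symm
    have hgg : ∀ x, g (g x) = x := by
      intro x
      rcases hcases x with h | rfl | rfl | rfl | rfl
      · rw [hgQ x h, hgQ _ (f ⟨x, h⟩).2, Subtype.coe_eta, hff]
      · rw [ga, gb]
      · rw [gb, ga]
      · rw [gc, gd]
      · rw [gd, gc]
    obtain ⟨P', hP', hPg⟩ := exists_isPerfectMatching_of_involution hgadj hgg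
    exact ⟨P', hP', ga ▸ hPg a, gc ▸ hPg c⟩
  · right
    rw [tutte] at hP
    push Not at hP
    obtain ⟨T, hT⟩ := hP
    unfold IsTutteViolator at hT
    set S : Finset V := {a, b, c, d} ∪ (Set.toFinite (Subtype.val '' T)).toFinset with hS
    set K := ((⊤ : (H.induce Q).Subgraph).deleteVerts T).coe with hK
    have hmemS : ∀ x, x ∈ S ↔ x ∉ Q ∨ ∃ h : x ∈ Q, (⟨x, h⟩ : Q) ∈ T := by
      intro x
      simp [hS, hQ]
      tauto
    set ι : ((⊤ : (H.induce Q).Subgraph).deleteVerts T).verts → V := fun w => w.1.1 with hι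
    have hinj : ι.Injective := fun w w' h => Subtype.ext (Subtype.ext h)
    have hιS : ∀ w, ι w ∉ S := by
      rintro ⟨⟨x, hx⟩, hw⟩
      rw [hmemS]
      have := hw.2
      grind
    have hιS' : ∀ x ∉ S, ∃ w, ι w = x := by
      intro x hx
      rw [hmemS] at hx
      push Not at hx
      exact ⟨⟨⟨x, hx.1⟩, trivial, hx.2 hx.1⟩, rfl⟩
    have hιK : ∀ w w', H.Adj (ι w) (ι w') → K.Adj w w' := by
      intro w w' h
      have hw := w.2.2
      have hw' := w'.2.2
      simp only [hK, Subgraph.coe_adj, Subgraph.deleteVerts_adj, Subgraph.verts_top, Set.mem_univ,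
        Subgraph.top_adj, true_and]
      exact ⟨hw, hw', h⟩
    have hfam := oddFamily_compFamily (H := H) (S := S) hinj hιS hιS' hιK
    refine ⟨S, _, by simp [hS], by simp [hS], by simp [hS], by simp [hS], hfam, ?_⟩
    have h5 : (compFamily K ι).card = K.oddComponents.ncard := card_compFamily hinj
    have h6 : S.card ≤ 4 + T.ncard := by
      refine (Finset.card_union_le _ _).trans (add_le_add Finset.card_le_four ?_)
      rw [← Set.ncard_eq_toFinset_card]
      exact Set.ncard_image_le (Set.toFinite _)
    omega

theorem MinimalKExt.exists_config (hG : Ambient G) (hmin : MinimalKExt G 2) {u v : V}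
    (huv : G.Adj u v) : ∃ S F A B, Config G u v S F A B := by
  refine hG.exists_config huv ?_
  by_contra hno
  refine hmin.2 s(u, v) huv ⟨hG.deleteEdges_connected huv,
    hG.deleteEdges_exists_isPerfectMatching huv, fun M hM hcard => ?_⟩
  obtain ⟨a, b, c, d, hab, hcd, h1, h2, h3, h4⟩ := hM.exists_two hcard.ge
  have hGle := G.deleteEdges_le {s(u, v)}
  rcases exists_isPerfectMatching_or_oddFamily hab.adj_sub hcd.adj_sub h1 h2 h3 h4 with
    ⟨P, hP, hPa, hPc⟩ | ⟨S, F, ha, hb, hc, hd, hF, hle⟩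
  · refine ⟨P, hP, fun x _ => hP.2 x, fun x y hxy => ?_⟩
    have heq : ({s(a, b), s(c, d)} : Set (Sym2 V)) = M.edgeSet := by
      refine Set.eq_of_subset_of_ncard_le ?_ ?_ (Set.toFinite _)
      · rintro e (rfl | rfl)
        exacts [hab, hcd]
      · rw [hcard, Set.ncard_pair]
        rw [Ne, Sym2.eq_iff]
        grind
    have hmem : s(x, y) ∈ M.edgeSet := hxy
    rw [← heq] at hmem
    rcases hmem with h | h
    · exact (Subgraph.mem_edgeSet (G' := P)).1 (h ▸ hPa)
    · exact (Subgraph.mem_edgeSet (G' := P)).1 (h ▸ hPc)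
  · exact absurd ⟨S, F, ⟨a, b, c, d, ha, hb, hc, hd, hGle hab.adj_sub, hGle hcd.adj_sub,
      h1, h2, h3, h4⟩, hF, hle⟩ hno

theorem Config.edgeSet_ncard_lt_three {u v : V} {S : Finset V} {F : Finset (Finset V)}
    {A B : Finset V} (h : Config G u v S F A B) (hG : Ambient G) {M : G.Subgraph}
    (hM : M.IsMatching) (hS : M.verts ⊆ S) : M.edgeSet.ncard < 3 := by
  by_contra! h3
  obtain ⟨a, b, c, d, e, f, hab, hcd, hef, hnd⟩ := hM.exists_three h3
  refine h.not_threeMatching hG hab.adj_sub hcd.adj_sub hef.adj_sub hnd fun x hx => ?_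
  simp only [List.mem_toFinset, List.mem_cons, List.not_mem_nil, or_false] at hx
  refine hS ?_
  rcases hx with rfl | rfl | rfl | rfl | rfl | rfl
  exacts [M.edge_vert hab, M.edge_vert hab.symm, M.edge_vert hcd, M.edge_vert hcd.symm,
    M.edge_vert hef, M.edge_vert hef.symm]

end

theorem stmt15 {V : Type*} [Fintype V] (G : SimpleGraph V) [DecidableRel G.Adj]
    (hclaw : ClawFree G) (hmin : MinimalKExt G 2) (hdelta : 6 ≤ G.minDegree)
    (u v : V) (huv : G.Adj u v)
    (S : Set V) (hS : Admissible G 2 u v S)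
    (hSmin : ∀ S' : Set V, Admissible G 2 u v S' → S.ncard ≤ S'.ncard)
    (hu : u ∈ Sᶜ) (hv : v ∈ Sᶜ) :
    (∀ M : G.Subgraph, M.IsMatching → M.verts ⊆ S →
        (∀ M' : G.Subgraph, M'.IsMatching → M'.verts ⊆ S →
          M'.edgeSet.ncard ≤ M.edgeSet.ncard) →
        M.edgeSet.ncard = 2) ∧
    ((S.ncard = 4 ∧
        Set.ncard {C : (Ge G u v S).ConnectedComponent | Odd C.supp.ncard} = 2 ∧
        1 < ((Ge G u v S).connectedComponentMk ⟨u, hu⟩).supp.ncard ∧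
        1 < ((Ge G u v S).connectedComponentMk ⟨v, hv⟩).supp.ncard) ∨
      (S.ncard = 5 ∧
        Set.ncard {C : (Ge G u v S).ConnectedComponent | Odd C.supp.ncard} = 3 ∧
        ((Ge G u v S).connectedComponentMk ⟨u, hu⟩).supp.ncard = 1 ∧
        ((Ge G u v S).connectedComponentMk ⟨v, hv⟩).supp.ncard = 1 ∧
        (∀ C : (Ge G u v S).ConnectedComponent, ¬ Even C.supp.ncard) ∧
        ∀ M : G.Subgraph, M.IsMatching → M.verts ⊆ S →
          (∀ M' : G.Subgraph, M'.IsMatching → M'.verts ⊆ S →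
            M'.edgeSet.ncard ≤ M.edgeSet.ncard) →
          ∀ w ∈ S, w ∉ M.verts →
            G.Adj u w ∧ G.Adj v w ∧
            ∃ y, ∃ (hy : y ∈ Sᶜ), G.Adj w y ∧
              Odd ((Ge G u v S).connectedComponentMk ⟨y, hy⟩).supp.ncard ∧
              (Ge G u v S).connectedComponentMk ⟨y, hy⟩ ≠
                (Ge G u v S).connectedComponentMk ⟨u, hu⟩ ∧
              (Ge G u v S).connectedComponentMk ⟨y, hy⟩ ≠
                (Ge G u v S).connectedComponentMk ⟨v, hv⟩)) := by
  classical
  have hG := hmin.1.ambient hclaw hdelta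
  have hE : ∀ u v, G.Adj u v → ∃ S F A B, Config G u v S F A B :=
    fun u v huv => MinimalKExt.exists_config hG hmin huv
  lift S to Finset V using Set.toFinite S
  have hc := hS.config hG huv
    (fun S' hS' => by simpa only [Set.ncard_coe_finset] using hSmin S' hS') hu hv
  obtain ⟨-, -, ⟨M₀, hM₀, hM₀S, hM₀card⟩, hodd, -⟩ := hS
  have hι : (Subtype.val : ↥((S : Set V)ᶜ) → V).Injective := Subtype.val_injective
  have hmax : ∀ M : G.Subgraph, M.IsMatching → M.verts ⊆ S →
      (∀ M' : G.Subgraph, M'.IsMatching → M'.verts ⊆ S →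
        M'.edgeSet.ncard ≤ M.edgeSet.ncard) → M.edgeSet.ncard = 2 := by
    intro M hM hMS hle
    have := hle M₀ hM₀ hM₀S
    have := hc.edgeSet_ncard_lt_three hG hM hMS
    omega
  have hcard : (S : Set V).ncard = S.card := Set.ncard_coe_finset S
  refine ⟨hmax, (hc.card_eq_four_or_five hG).imp (fun h4 => ?_) fun h5 => ?_⟩
  · refine ⟨hcard.trans h4, by omega, ?_, ?_⟩
    · exact card_compSet hι _ ▸ hc.one_lt_card_of_card_eq_four hG h4
    · exact card_compSet hι _ ▸ hc.symm.one_lt_card_of_card_eq_four hG h4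
  have hA := hc.eq_singleton_of_card_eq_five hG hE h5
  have hB := hc.symm.eq_singleton_of_card_eq_five hG hE h5
  refine ⟨hcard.trans h5, by omega, ?_, ?_, fun C hC => ?_, fun M hM hMS hle w hw hwM => ?_⟩
  · rw [← card_compSet hι, hA, Finset.card_singleton]
  · rw [← card_compSet hι, hB, Finset.card_singleton]
  · obtain ⟨⟨z, hz⟩, rfl⟩ := C.exists_rep
    obtain ⟨O, hO, hzO⟩ := hc.exists_mem_of_notMem hG h5 hA (z := z) (by simpa using hz)
    obtain ⟨C', hC', rfl⟩ := mem_compFamily.1 hO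
    obtain ⟨w, rfl, e⟩ := mem_compSet.1 hzO
    obtain rfl : w = ⟨z, hz⟩ := Subtype.ext e
    exact Nat.not_even_iff_odd.2 hC' hC
  · have htwo : TwoMatching G (S.erase w) := by
      refine hM.twoMatching (hmax M hM hMS hle).ge fun x hx => ?_
      rw [Finset.mem_coe, Finset.mem_erase]
      exact ⟨fun e => hwM (e ▸ hx), hMS hx⟩
    obtain ⟨h1, h2, O, hO, hOA, hOB, ⟨y, hyO, hwy⟩, -⟩ := hc.special hclaw hw htwo
    obtain ⟨C, hC, rfl⟩ := mem_compFamily.1 hO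
    obtain ⟨⟨y, hy⟩, rfl, rfl⟩ := mem_compSet.1 hyO
    exact ⟨h1, h2, y, hy, hwy, hC, fun e => hOA (congrArg _ e), fun e => hOB (congrArg _ e)⟩
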